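/- arXiv:1311.2322 — 3 statements merged into one kernel-verified Lean document; each statement's English description precedes it below -/
import Mathlib

section
/- Let n ≥ 3 and let ε ∈ {−1,1}ⁿ be the sign pattern with ε_{n−1} = −1 and ε_i = 1 for all i ≠ n−1. Then for all exponents p_1,…,p_n ≥ 1, the operator C_n^ε is not bounded from L^{p_1} × ⋯ × L^{p_n} into L^{1/(Σ_{i=1}^n 1/p_i)}: for every constant C > 0 there exist Schwartz functions f_1,…,f_n with compactly supported Fourier transforms such that ‖C_n^ε(f_1,…,f_n)‖_{L^{1/(Σ 1/p_i)}(ℝ)} > C ∏_{i=1}^n ‖f_i‖_{L^{p_i}}. -/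
open MeasureTheory Complex
open scoped FourierTransform Real ENNReal

/-- The multilinear oscillatory integral operator `C_n^ε`. -/
noncomputable def Cop {n : ℕ} (ε : Fin n → ℝ) (f : Fin n → ℝ → ℂ) (x : ℝ) : ℂ :=
  ∫ t in {t : Fin n → ℝ | StrictMono t},
    (∏ i, 𝓕 (f i) (t i)) * Complex.exp (2 * π * Complex.I * x * ∑ i, ε i * t i)

/-- The character `t ↦ e^{2πit}`. -/
noncomputable def unitChar (t : ℝ) : ℂ := Complex.exp (2 * π * t * Complex.I)

lemma unitChar_add (s t : ℝ) : unitChar (s + t) = unitChar s * unitChar t := by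
  rw [unitChar, unitChar, unitChar, ← Complex.exp_add]
  push_cast
  ring_nf

lemma norm_unitChar (t : ℝ) : ‖unitChar t‖ = 1 := by
  rw [unitChar, show (2 * π * t * I : ℂ) = ((2 * π * t : ℝ) : ℂ) * I by push_cast; ring]
  exact Complex.norm_exp_ofReal_mul_I _

lemma unitChar_zero : unitChar 0 = 1 := by simp [unitChar]

lemma unitChar_sum {ι : Type*} (s : Finset ι) (t : ι → ℝ) :
    unitChar (∑ i ∈ s, t i) = ∏ i ∈ s, unitChar (t i) := by
  simp only [unitChar]
  rw [← Complex.exp_sum]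
  push_cast
  rw [Finset.mul_sum, Finset.sum_mul]

lemma unitChar_neg (t : ℝ) : unitChar (-t) = starRingEnd ℂ (unitChar t) := by
  rw [unitChar, unitChar, ← Complex.exp_conj]
  simp [map_ofNat]

lemma continuous_unitChar : Continuous unitChar := by
  unfold unitChar
  fun_prop

lemma unitChar_int (k : ℤ) : unitChar k = 1 := by
  rw [unitChar]
  push_cast
  rw [show (2 * π * k * I : ℂ) = k * (2 * π * I) by ring]
  exact Complex.exp_int_mul_two_pi_mul_I k

lemma unitChar_re (t : ℝ) : (unitChar t).re = Real.cos (2 * π * t) := by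
  rw [unitChar, show (2 * π * t * I : ℂ) = ((2 * π * t : ℝ) : ℂ) * I by push_cast; ring]
  exact Complex.exp_ofReal_mul_I_re _

lemma unitChar_im (t : ℝ) : (unitChar t).im = Real.sin (2 * π * t) := by
  rw [unitChar, show (2 * π * t * I : ℂ) = ((2 * π * t : ℝ) : ℂ) * I by push_cast; ring]
  exact Complex.exp_ofReal_mul_I_im _

/-- A smooth nonnegative bump on the frequency side, supported in `[-1/8, 1/8]`. -/
noncomputable def freqBump : ContDiffBump (0 : ℝ) := ⟨1 / 16, 1 / 8, by norm_num, by norm_num⟩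

/-- The inverse Fourier transform of `freqBump`. -/
noncomputable def window (x : ℝ) : ℂ := ∫ ξ, (freqBump ξ : ℂ) * unitChar (x * ξ)

lemma freqBump_eq_zero {ξ : ℝ} (h : 1 / 2 ≤ |ξ|) : freqBump ξ = 0 := by
  apply freqBump.zero_of_le_dist
  rw [Real.dist_eq, sub_zero]
  exact le_trans (show (1 / 8 : ℝ) ≤ 1 / 2 by norm_num) h

lemma contDiff_freqBump : ContDiff ℝ (⊤ : ℕ∞) (fun ξ => (freqBump ξ : ℂ)) :=
  Complex.ofRealCLM.contDiff.comp freqBump.contDiff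

lemma hasCompactSupport_freqBump : HasCompactSupport (fun ξ => (freqBump ξ : ℂ)) :=
  freqBump.hasCompactSupport.comp_left (g := fun y : ℝ => (y : ℂ)) rfl

lemma integrable_freqBump_mul (k x : ℝ) :
    Integrable (fun ξ => (freqBump (ξ - k) : ℂ) * unitChar (x * ξ)) := by
  apply Continuous.integrable_of_hasCompactSupport
  · exact (contDiff_freqBump.continuous.comp (continuous_id.sub continuous_const)).mul
      (continuous_unitChar.comp (continuous_const.mul continuous_id))
  · apply HasCompactSupport.mul_right
    exact hasCompactSupport_freqBump.comp_homeomorph (Homeomorph.subRight k)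

lemma integral_freqBump_mul (k x : ℝ) :
    ∫ ξ, (freqBump (ξ - k) : ℂ) * unitChar (x * ξ) = unitChar (x * k) * window x := by
  rw [← integral_add_right_eq_self _ k, window, ← integral_const_mul]
  congr 1
  ext ξ
  rw [add_sub_cancel_right, mul_add, unitChar_add]
  ring

lemma exists_le_norm_window : ∃ c > 0, ∀ x : ℝ, |x| ≤ 1 → c ≤ ‖window x‖ := by
  refine ⟨Real.cos (π / 4) * ∫ ξ, freqBump ξ, ?_, fun x hx => ?_⟩
  · refine mul_pos (Real.cos_pos_of_mem_Ioo ⟨?_, ?_⟩) freqBump.integral_pos <;>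
      linarith [Real.pi_pos]
  · refine le_trans ?_ (Complex.re_le_norm _)
    have h0 := integrable_freqBump_mul 0 x
    simp only [sub_zero] at h0
    have h1 : (window x).re = ∫ ξ, freqBump ξ * Real.cos (2 * π * (x * ξ)) := by
      rw [window]
      refine (integral_re h0).symm.trans ?_
      congr 1
      ext ξ
      rw [RCLike.re_eq_complex_re, Complex.re_ofReal_mul, unitChar_re]
    rw [h1, ← integral_const_mul]
    apply integral_mono
    · exact (freqBump.integrable).const_mul _
    · refine h0.re.congr (.of_forall fun ξ => ?_)
      simp only [RCLike.re_eq_complex_re, Complex.re_ofReal_mul, unitChar_re]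
    · intro ξ
      dsimp only
      by_cases hξ : 1 / 8 ≤ |ξ|
      · rw [freqBump.zero_of_le_dist (by rw [Real.dist_eq, sub_zero]; exact hξ)]
        simp
      · rw [mul_comm]
        refine mul_le_mul_of_nonneg_left ?_ freqBump.nonneg
        rw [← Real.cos_abs (2 * π * (x * ξ))]
        apply Real.cos_le_cos_of_nonneg_of_le_pi (abs_nonneg _)
        · linarith [Real.pi_pos]
        · rw [abs_mul, abs_mul x, abs_of_pos Real.two_pi_pos]
          have : |x| * |ξ| ≤ 1 * (1 / 8) :=
            mul_le_mul hx (le_of_not_ge hξ) (abs_nonneg _) zero_le_one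
          nlinarith [Real.pi_pos]

lemma exists_wavePacketSum {ι : Type*} (s : Finset ι) (α : ι → ℂ) (l : ι → ℤ) :
    ∃ f : SchwartzMap ℝ ℂ, HasCompactSupport (𝓕 ⇑f) ∧
      (𝓕 ⇑f = fun ξ => ∑ k ∈ s, α k * (freqBump (ξ - l k) : ℂ)) ∧
      ∀ x, f x = (∑ k ∈ s, α k * unitChar (x * l k)) * window x := by
  have hs : ∀ k, HasCompactSupport (fun ξ : ℝ => α k * (freqBump (ξ - l k) : ℂ)) := fun k =>
    HasCompactSupport.mul_left (f := fun _ => α k)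
      (hasCompactSupport_freqBump.comp_homeomorph (Homeomorph.subRight (l k : ℝ)))
  have hc : HasCompactSupport (fun ξ : ℝ => ∑ k ∈ s, α k * (freqBump (ξ - l k) : ℂ)) := by
    classical
    induction s using Finset.induction_on with
    | empty => simpa using! (HasCompactSupport.zero : HasCompactSupport (0 : ℝ → ℂ))
    | insert a s ha ih =>
      simp only [Finset.sum_insert ha]
      exact (hs a).add ih
  have hd : ContDiff ℝ (⊤ : ℕ∞) (fun ξ : ℝ => ∑ k ∈ s, α k * (freqBump (ξ - l k) : ℂ)) :=
    ContDiff.sum fun k _ => contDiff_const.mul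
      (contDiff_freqBump.comp (contDiff_id.sub contDiff_const))
  let f : SchwartzMap ℝ ℂ := 𝓕⁻ (hc.toSchwartzMap hd)
  have hF : 𝓕 ⇑f = fun ξ : ℝ => ∑ k ∈ s, α k * (freqBump (ξ - l k) : ℂ) := by
    rw [← SchwartzMap.fourier_coe, FourierTransform.fourier_fourierInv_eq]
    rfl
  refine ⟨f, by rw [hF]; exact hc, hF, fun x => ?_⟩
  rw [SchwartzMap.fourierInv_coe, Real.fourierInv_eq']
  have : ∀ v : ℝ, cexp (↑(2 * π * inner ℝ v x) * I) • (hc.toSchwartzMap hd) v =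
      ∑ k ∈ s, α k * ((freqBump (v - l k) : ℂ) * unitChar (x * v)) := by
    intro v
    change _ • (∑ k ∈ s, α k * (freqBump (v - l k) : ℂ)) = _
    rw [smul_eq_mul, Finset.mul_sum]
    refine Finset.sum_congr rfl fun k _ => ?_
    rw [unitChar, real_inner_comm]
    simp
    ring_nf
  simp_rw [this]
  rw [integral_finsetSum _ fun k _ => (integrable_freqBump_mul _ x).const_mul _, Finset.sum_mul]
  refine Finset.sum_congr rfl fun k _ => ?_
  rw [integral_const_mul, integral_freqBump_mul, mul_assoc]

lemma measurableSet_strictMono (n : ℕ) : MeasurableSet {t : Fin n → ℝ | StrictMono t} := by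
  have : {t : Fin n → ℝ | StrictMono t} = ⋂ i, ⋂ j, {t | i < j → t i < t j} := by
    ext t
    simp [StrictMono]
  rw [this]
  refine MeasurableSet.iInter fun i => MeasurableSet.iInter fun j => ?_
  by_cases h : i < j
  · simpa [h] using measurableSet_lt (measurable_pi_apply i) (measurable_pi_apply j)
  · simp [h]

lemma strictMono_iff_of_abs_sub_lt {n : ℕ} {t : Fin n → ℝ} {k : Fin n → ℤ}
    (hk : Function.Injective k) (h : ∀ i, |t i - k i| < 1 / 2) : StrictMono t ↔ StrictMono k := by
  have key : ∀ i j, k i < k j → t i < t j := fun i j hij => by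
    have h1 : (k i : ℝ) + 1 ≤ k j := by exact_mod_cast hij
    have h2 := abs_lt.1 (h i)
    have h3 := abs_lt.1 (h j)
    linarith [h2.2, h3.1]
  refine ⟨fun ht i j hij => ?_, fun hk i j hij => key i j (hk hij)⟩
  by_contra hlt
  have : k j < k i := lt_of_le_of_ne (not_lt.1 hlt) fun he => hij.ne' (hk he)
  exact absurd (ht hij) (key j i this).not_gt

open Classical in
lemma setIntegral_strictMono_prod_freqBump {n : ℕ} (ε : Fin n → ℝ) (x : ℝ) (k : Fin n → ℤ)
    (hk : Function.Injective k) :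
    ∫ t in {t : Fin n → ℝ | StrictMono t},
      ∏ i, ((freqBump (t i - k i) : ℂ) * unitChar (x * ε i * t i)) =
    if StrictMono k then ∏ i, (unitChar (x * ε i * k i) * window (x * ε i)) else 0 := by
  rw [← integral_indicator (measurableSet_strictMono n)]
  have h : ∀ t : Fin n → ℝ, Set.indicator {t : Fin n → ℝ | StrictMono t}
      (fun t => ∏ i, ((freqBump (t i - k i) : ℂ) * unitChar (x * ε i * t i))) t =
      if StrictMono k then ∏ i, ((freqBump (t i - k i) : ℂ) * unitChar (x * ε i * t i))
        else 0 := by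
    intro t
    simp only [Set.indicator_apply, Set.mem_ofPred_eq]
    by_cases ht : ∀ i, |t i - k i| < 1 / 2
    · simp only [strictMono_iff_of_abs_sub_lt hk ht]
    · push Not at ht
      obtain ⟨i, hi⟩ := ht
      have : ∏ i, ((freqBump (t i - k i) : ℂ) * unitChar (x * ε i * t i)) = 0 :=
        Finset.prod_eq_zero (Finset.mem_univ i) (by rw [freqBump_eq_zero hi]; simp)
      simp [this]
  simp_rw [h]
  split_ifs
  · rw [integral_fintype_prod_volume_eq_prod
      (f := fun i (ξ : ℝ) => (freqBump (ξ - k i) : ℂ) * unitChar (x * ε i * ξ))]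
    simp_rw [integral_freqBump_mul]
  · simp

open Classical in
lemma Cop_wavePacketSum {n : ℕ} {ι : Type*} (ε : Fin n → ℝ) (s : Fin n → Finset ι)
    (α : Fin n → ι → ℂ) (l : Fin n → ι → ℤ) (f : Fin n → ℝ → ℂ)
    (hf : ∀ i, 𝓕 (f i) = fun ξ => ∑ k ∈ s i, α i k * (freqBump (ξ - l i k) : ℂ))
    (hl : ∀ i j, i ≠ j → ∀ k ∈ s i, ∀ k' ∈ s j, l i k ≠ l j k') (x : ℝ) :
    Cop ε f x = (∏ i, window (x * ε i)) *
      ∑ k ∈ (Fintype.piFinset s).filter (fun k => StrictMono fun i => l i (k i)),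
        (∏ i, α i (k i)) * unitChar (x * ∑ i, ε i * l i (k i)) := by
  have h1 : ∀ t : Fin n → ℝ,
      (∏ i, 𝓕 (f i) (t i)) * Complex.exp (2 * π * Complex.I * x * ∑ i, ε i * t i) =
      ∑ k ∈ Fintype.piFinset s, (∏ i, α i (k i)) *
        ∏ i, ((freqBump (t i - l i (k i)) : ℂ) * unitChar (x * ε i * t i)) := by
    intro t
    simp_rw [hf]
    rw [Finset.prod_univ_sum, Finset.sum_mul]
    refine Finset.sum_congr rfl fun k _ => ?_
    have : Complex.exp (2 * π * Complex.I * x * ∑ i, ε i * t i) =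
        ∏ i, unitChar (x * ε i * t i) := by
      rw [← unitChar_sum, unitChar]
      congr 1
      push_cast
      simp_rw [mul_assoc, ← Finset.mul_sum]
      ring
    rw [this, ← Finset.prod_mul_distrib, ← Finset.prod_mul_distrib]
    exact Finset.prod_congr rfl fun i _ => by ring
  rw [Cop]
  simp_rw [h1]
  rw [integral_finsetSum]
  · rw [Finset.mul_sum, Finset.sum_filter]
    refine Finset.sum_congr rfl fun k hk => ?_
    rw [integral_const_mul, setIntegral_strictMono_prod_freqBump]
    · split_ifs
      · rw [Finset.prod_mul_distrib, ← unitChar_sum]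
        simp_rw [mul_assoc, ← Finset.mul_sum]
        ring
      · simp
    · intro i j hij
      by_contra hne
      rw [Fintype.mem_piFinset] at hk
      exact hl i j hne _ (hk i) _ (hk j) hij
  · intro k _
    apply Integrable.integrableOn
    apply Integrable.const_mul
    exact Integrable.fintype_prod
      (f := fun i (ξ : ℝ) => (freqBump (ξ - l i (k i)) : ℂ) * unitChar (x * ε i * ξ))
      fun i => integrable_freqBump_mul _ _

lemma unitChar_nat_mul (n : ℕ) (t : ℝ) : unitChar (n * t) = unitChar t ^ n := by
  rw [unitChar, unitChar, ← Complex.exp_nat_mul]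
  push_cast
  ring_nf

lemma unitChar_eq_one_iff {t : ℝ} : unitChar t = 1 ↔ ∃ k : ℤ, t = k := by
  refine ⟨fun h => ?_, fun ⟨k, hk⟩ => by rw [hk, unitChar_int]⟩
  rw [unitChar, Complex.exp_eq_one_iff] at h
  obtain ⟨k, hk⟩ := h
  refine ⟨k, ?_⟩
  have h1 : (2 * π * I : ℂ) ≠ 0 := Complex.two_pi_I_ne_zero
  have h2 : (2 * π * I : ℂ) * t = 2 * π * I * k := by linear_combination hk
  exact_mod_cast mul_left_cancel₀ h1 h2

lemma sum_unitChar_div (N : ℕ) (j : ℤ) (hj : |j| < N) :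
    ∑ l ∈ Finset.range N, unitChar (l * (j / N)) = if j = 0 then (N : ℂ) else 0 := by
  split_ifs with h
  · simp [h, unitChar_zero]
  · have hN : (N : ℝ) ≠ 0 := by
      have := (abs_nonneg j).trans_lt hj
      exact_mod_cast this.ne'
    simp_rw [unitChar_nat_mul]
    have h1 : unitChar (j / N) ≠ 1 := by
      rw [Ne, unitChar_eq_one_iff]
      rintro ⟨k, hk⟩
      rw [div_eq_iff hN] at hk
      have hk' : j = k * N := by exact_mod_cast hk
      rcases eq_or_ne k 0 with rfl | hk0
      · exact h (by simpa using hk')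
      · rw [hk', abs_mul, Nat.abs_cast] at hj
        have : 1 ≤ |k| := Int.one_le_abs hk0
        nlinarith
    rw [geom_sum_eq h1, ← unitChar_nat_mul, mul_div_cancel₀ _ hN, unitChar_int]
    simp

lemma sum_norm_sq_dft_le {N P Q : ℕ} (hP : P ≤ N) (hQ : Q ≤ N) (σ : ℤ) (hσ : |σ| = 1)
    (β : ℕ → ℂ) (hβ : ∀ l, ‖β l‖ = 1) :
    ∑ l ∈ Finset.range P, ‖∑ r ∈ Finset.range Q, β r * unitChar (l * (σ * r / N))‖ ^ 2 ≤
      N * Q := by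
  have hσ0 : σ ≠ 0 := by
    rintro rfl
    simp at hσ
  have key : ((∑ l ∈ Finset.range N,
      ‖∑ r ∈ Finset.range Q, β r * unitChar (l * (σ * r / N))‖ ^ 2 : ℝ) : ℂ) = N * Q := by
    push_cast
    have h1 : ∀ l ∈ Finset.range N,
        (‖∑ r ∈ Finset.range Q, β r * unitChar (l * (σ * r / N))‖ : ℂ) ^ 2 =
        ∑ r ∈ Finset.range Q, ∑ r' ∈ Finset.range Q, (β r * starRingEnd ℂ (β r')) *
          unitChar (l * ((σ * ((r : ℤ) - r') : ℤ) / N)) := by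
      intro l _
      rw [← Complex.mul_conj', map_sum, Finset.sum_mul_sum]
      refine Finset.sum_congr rfl fun r _ => Finset.sum_congr rfl fun r' _ => ?_
      rw [map_mul, ← unitChar_neg, show (l * ((σ * ((r : ℤ) - r') : ℤ) / N) : ℝ) =
        l * (σ * r / N) + -(l * (σ * r' / N)) by push_cast; ring, unitChar_add]
      ring
    rw [Finset.sum_congr rfl h1, Finset.sum_comm]
    have h2 : ∀ r ∈ Finset.range Q, ∑ l ∈ Finset.range N, ∑ r' ∈ Finset.range Q,
        (β r * starRingEnd ℂ (β r')) * unitChar (l * ((σ * ((r : ℤ) - r') : ℤ) / N)) = N := by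
      intro r hr
      rw [Finset.sum_comm]
      have h3 : ∀ r' ∈ Finset.range Q, ∑ l ∈ Finset.range N,
          (β r * starRingEnd ℂ (β r')) * unitChar (l * ((σ * ((r : ℤ) - r') : ℤ) / N)) =
          if r = r' then (N : ℂ) else 0 := by
        intro r' hr'
        rw [Finset.mem_range] at hr hr'
        rw [← Finset.mul_sum, sum_unitChar_div N _ (by rw [abs_mul, hσ, one_mul, abs_lt]; omega)]
        rcases eq_or_ne r r' with rfl | h
        · simp [Complex.mul_conj', hβ]
        · have : (r : ℤ) - r' ≠ 0 := by omega
          simp [h, hσ0, this]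
      rw [Finset.sum_congr rfl h3, Finset.sum_ite_eq, if_pos hr]
    rw [Finset.sum_congr rfl h2]
    simp [mul_comm]
  have key' : ∑ l ∈ Finset.range N,
      ‖∑ r ∈ Finset.range Q, β r * unitChar (l * (σ * r / N))‖ ^ 2 = N * Q := by
    exact_mod_cast key
  rw [← key']
  exact Finset.sum_le_sum_of_subset_of_nonneg (Finset.range_subset_range.2 hP)
    fun _ _ _ => by positivity

lemma norm_sum_sum_chirp_le {N P Q : ℕ} (hN : 0 < N) (hP : P ≤ N) (hQ : Q ≤ N) (σ : ℤ)
    (hσ : |σ| = 1) (κ : ℤ) (y : ℝ) :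
    ‖∑ l ∈ Finset.range P, ∑ r ∈ Finset.range Q,
      unitChar (σ * ((κ + l - r : ℤ) : ℝ) ^ 2 / (2 * N) + y * ((κ + l - r : ℤ) : ℝ))‖ ≤
      √(N * P * Q) := by
  have hN' : (N : ℝ) ≠ 0 := by positivity
  set T : ℕ → ℂ := fun l => ∑ r ∈ Finset.range Q,
    unitChar (σ * (r ^ 2 - 2 * κ * r) / (2 * N) - y * r) * unitChar (l * ((-σ : ℤ) * r / N))
    with hT
  have h1 : ∀ l ∈ Finset.range P, ∑ r ∈ Finset.range Q,
      unitChar (σ * ((κ + l - r : ℤ) : ℝ) ^ 2 / (2 * N) + y * ((κ + l - r : ℤ) : ℝ)) =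
      unitChar (σ * (κ + l) ^ 2 / (2 * N) + y * (κ + l)) * T l := by
    intro l _
    rw [hT, Finset.mul_sum]
    refine Finset.sum_congr rfl fun r _ => ?_
    rw [← unitChar_add, ← unitChar_add]
    congr 1
    push_cast
    field_simp
    ring
  rw [Finset.sum_congr rfl h1]
  apply Real.le_sqrt_of_sq_le
  calc ‖∑ l ∈ Finset.range P, unitChar (σ * (κ + l) ^ 2 / (2 * N) + y * (κ + l)) * T l‖ ^ 2
      ≤ (∑ l ∈ Finset.range P, ‖T l‖) ^ 2 := by
        gcongr
        refine (norm_sum_le _ _).trans_eq (Finset.sum_congr rfl fun l _ => ?_)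
        rw [norm_mul, norm_unitChar, one_mul]
    _ ≤ P * ∑ l ∈ Finset.range P, ‖T l‖ ^ 2 := by
        simpa using sq_sum_le_card_mul_sum_sq (s := Finset.range P) (f := fun l => ‖T l‖)
    _ ≤ P * (N * Q) := by
        gcongr
        exact sum_norm_sq_dft_le hP hQ (-σ) (by rwa [abs_neg]) _ fun _ => norm_unitChar _
    _ = N * P * Q := by ring

/-- The number of representations `j = l - r` with `0 ≤ l < P` and `0 ≤ r < Q`. -/
noncomputable def diffCount (P Q : ℕ) (j : ℤ) : ℝ :=
  ((Finset.range P ×ˢ Finset.range Q).filter fun q => (q.1 : ℤ) - q.2 = j).card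

lemma diffCount_eq (P Q : ℕ) (j : ℤ) :
    diffCount P Q j = ((min (P : ℤ) (Q + j) - max 0 j).toNat : ℝ) := by
  rw [diffCount, ← Int.card_Ico]
  congr 1
  apply Finset.card_nbij' (fun q => (q.1 : ℤ)) (fun l => (l.toNat, (l - j).toNat))
  · intro q hq
    simp at hq ⊢
    omega
  · intro l hl
    simp at hl ⊢
    omega
  · intro q hq
    simp at hq ⊢
    exact Prod.ext (by simp) (by simp; omega)
  · intro l hl
    simp at hl ⊢
    omega

lemma sum_diffCount_mul (P Q : ℕ) (κ : ℤ) (s : Finset ℤ)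
    (hs : Finset.Ioo (κ - Q) (κ + P) ⊆ s) (g : ℤ → ℂ) :
    ∑ k ∈ s, (diffCount P Q (k - κ) : ℂ) * g k =
      ∑ l ∈ Finset.range P, ∑ r ∈ Finset.range Q, g (κ + l - r) := by
  rw [← Finset.sum_product', ← Finset.sum_fiberwise_of_maps_to (t := s)
    (g := fun q : ℕ × ℕ => κ + q.1 - q.2)]
  · refine Finset.sum_congr rfl fun k _ => ?_
    rw [Finset.sum_congr rfl (g := fun _ => g k), Finset.sum_const, nsmul_eq_mul, diffCount]
    · congr 4
      ext q
      simp only [Finset.mem_filter]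
      exact and_congr_right fun _ => by omega
    · intro q hq
      rw [(Finset.mem_filter.1 hq).2]
  · intro q hq
    apply hs
    simp at hq ⊢
    omega

lemma norm_sum_diffCount_mul_chirp_le {N P Q : ℕ} (hN : 0 < N) (hP : P ≤ N) (hQ : Q ≤ N) (σ : ℤ)
    (hσ : |σ| = 1) (κ : ℤ) (s : Finset ℤ) (hs : Finset.Ioo (κ - Q) (κ + P) ⊆ s) (y : ℝ) :
    ‖∑ k ∈ s, (diffCount P Q (k - κ) : ℂ) *
      unitChar (σ * (k : ℝ) ^ 2 / (2 * N) + y * k)‖ ≤ √(N * P * Q) := by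
  rw [sum_diffCount_mul P Q κ s hs
    (fun k => unitChar (σ * (k : ℝ) ^ 2 / (2 * N) + y * k))]
  exact norm_sum_sum_chirp_le hN hP hQ σ hσ κ y

lemma one_sub_mul_sum_sub_mul_pow (z : ℂ) (m : ℕ) :
    (1 - z) * ∑ v ∈ Finset.range (m + 1), ((m : ℂ) - v) * z ^ v =
      m - z * ∑ v ∈ Finset.range m, z ^ v := by
  induction m with
  | zero => simp
  | succ m ih =>
    have h1 : ∑ v ∈ Finset.range (m + 1 + 1), (((m + 1 : ℕ) : ℂ) - v) * z ^ v =
        ∑ v ∈ Finset.range (m + 1), ((m : ℂ) - v) * z ^ v +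
          ∑ v ∈ Finset.range (m + 1), z ^ v := by
      rw [Finset.sum_range_succ, ← Finset.sum_add_distrib]
      simp only [sub_self, zero_mul, add_zero]
      refine Finset.sum_congr rfl fun v _ => ?_
      push_cast
      ring
    have h2 := mul_neg_geom_sum z (m + 1)
    rw [h1, mul_add, ih, h2, Finset.sum_range_succ]
    push_cast
    ring

lemma norm_sum_sub_mul_pow_le {z : ℂ} (hz : ‖z‖ = 1) (m : ℕ) :
    ‖1 - z‖ * ‖∑ v ∈ Finset.range (m + 1), ((m : ℂ) - v) * z ^ v‖ ≤ 2 * m := by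
  rw [← norm_mul, one_sub_mul_sum_sub_mul_pow]
  refine (norm_sub_le _ _).trans ?_
  rw [norm_mul, hz, one_mul, Complex.norm_natCast, two_mul]
  gcongr
  refine (norm_sum_le _ _).trans_eq ?_
  simp [hz]

lemma le_norm_one_sub_unitChar {t : ℝ} (h0 : 0 ≤ t) (h1 : t ≤ 1 / 2) :
    4 * t ≤ ‖1 - unitChar t‖ := by
  rw [norm_sub_rev, unitChar, show (2 * π * t * I : ℂ) = I * ((2 * π * t : ℝ) : ℂ) by
    push_cast; ring, Complex.norm_exp_I_mul_ofReal_sub_one, Real.norm_eq_abs]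
  refine le_trans ?_ (le_abs_self _)
  have := Real.mul_le_sin (x := 2 * π * t / 2) (by positivity) (by nlinarith [Real.pi_pos])
  have h2 : 2 / π * (2 * π * t / 2) = 2 * t := by
    field_simp
  linarith

lemma sum_sub_mul_sin (θ : ℝ) (m : ℕ) :
    2 * (1 - Real.cos θ) * ∑ v ∈ Finset.range (m + 1), ((m : ℝ) - v) * Real.sin (v * θ) =
      m * Real.sin θ - Real.sin (m * θ) := by
  have h0 : ∀ m : ℕ, 2 * (1 - Real.cos θ) * ∑ v ∈ Finset.range (m + 1), Real.sin (v * θ) =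
      Real.sin θ + Real.sin (m * θ) - Real.sin ((m + 1) * θ) := by
    intro m
    induction m with
    | zero => simp
    | succ m ih =>
      rw [Finset.sum_range_succ, mul_add, ih]
      push_cast
      have e1 : Real.sin (((m : ℝ) + 1 + 1) * θ) = Real.sin ((m + 1) * θ) * Real.cos θ +
          Real.cos ((m + 1) * θ) * Real.sin θ := by
        rw [← Real.sin_add]; ring_nf
      have e2 : Real.sin (m * θ) = Real.sin ((m + 1) * θ) * Real.cos θ -
          Real.cos ((m + 1) * θ) * Real.sin θ := by
        rw [← Real.sin_sub]; ring_nf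
      rw [e1, e2]
      ring
  induction m with
  | zero => simp
  | succ m ih =>
    have h1 : ∑ v ∈ Finset.range (m + 1 + 1), (((m + 1 : ℕ) : ℝ) - v) * Real.sin (v * θ) =
        ∑ v ∈ Finset.range (m + 1), ((m : ℝ) - v) * Real.sin (v * θ) +
          ∑ v ∈ Finset.range (m + 1), Real.sin (v * θ) := by
      rw [Finset.sum_range_succ, ← Finset.sum_add_distrib]
      simp only [sub_self, zero_mul, add_zero]
      refine Finset.sum_congr rfl fun v _ => ?_
      push_cast
      ring
    rw [h1, mul_add, ih, h0]
    push_cast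
    ring

lemma abs_sin_nat_mul_le (θ : ℝ) (m : ℕ) : |Real.sin (m * θ)| ≤ m * |Real.sin θ| := by
  induction m with
  | zero => simp
  | succ m ih =>
    push_cast
    rw [add_mul, one_mul, Real.sin_add]
    calc |Real.sin (m * θ) * Real.cos θ + Real.cos (m * θ) * Real.sin θ|
        ≤ |Real.sin (m * θ)| * |Real.cos θ| + |Real.cos (m * θ)| * |Real.sin θ| := by
          rw [← abs_mul, ← abs_mul]
          exact abs_add_le _ _
      _ ≤ m * |Real.sin θ| * 1 + 1 * |Real.sin θ| := by
          gcongr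
          · exact Real.abs_cos_le_one _
          · exact Real.abs_cos_le_one _
      _ = (m + 1) * |Real.sin θ| := by ring

lemma sum_sub_mul_sin_nonneg {θ : ℝ} (h0 : 0 ≤ θ) (h1 : θ ≤ π) (m : ℕ) :
    0 ≤ ∑ v ∈ Finset.range (m + 1), ((m : ℝ) - v) * Real.sin (v * θ) := by
  rcases h0.eq_or_lt with rfl | hpos
  · simp
  have hc : Real.cos θ < 1 := by
    rw [← Real.cos_zero]
    exact Real.cos_lt_cos_of_nonneg_of_le_pi le_rfl h1 hpos
  have h2 := sum_sub_mul_sin θ m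
  have h3 := abs_sin_nat_mul_le θ m
  rw [abs_of_nonneg (Real.sin_nonneg_of_nonneg_of_le_pi h0 h1)] at h3
  refine nonneg_of_mul_nonneg_right (h2 ▸ ?_) (show 0 < 2 * (1 - Real.cos θ) by linarith)
  linarith [le_abs_self (Real.sin (m * θ))]

lemma le_sum_sub_mul_sin {θ : ℝ} (h0 : 0 < θ) (h1 : θ ≤ π / 2) (m : ℕ) (hm : π ≤ m * θ) :
    m / (π * θ) ≤ ∑ v ∈ Finset.range (m + 1), ((m : ℝ) - v) * Real.sin (v * θ) := by
  have hF := sum_sub_mul_sin_nonneg h0.le (by linarith [Real.pi_pos]) m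
  have h2 := sum_sub_mul_sin θ m
  set F := ∑ v ∈ Finset.range (m + 1), ((m : ℝ) - v) * Real.sin (v * θ)
  have h3 := Real.mul_le_sin h0.le h1
  have h4 := Real.one_sub_sq_div_two_le_cos (x := θ)
  have h5 : m * (2 / π * θ) ≤ m * Real.sin θ := by gcongr
  have h6 : 2 ≤ m * (2 / π * θ) := by
    rw [show m * (2 / π * θ) = 2 * (m * θ / π) by ring]
    have := (one_le_div Real.pi_pos).2 hm
    linarith
  have h7 : 2 * (1 - Real.cos θ) * F ≤ θ ^ 2 * F := by
    gcongr
    linarith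
  have h8 : m / π * θ ≤ θ ^ 2 * F := by
    have := Real.sin_le_one (m * θ)
    have e : m * (2 / π * θ) = 2 * (m / π * θ) := by ring
    linarith
  rw [div_le_iff₀ (by positivity)]
  have h9 : m / π ≤ θ * F := by
    refine le_of_mul_le_mul_right ?_ h0
    linarith
  rw [div_le_iff₀ Real.pi_pos] at h9
  linarith

/-- The Fourier coefficient, up to a unimodular factor, of the trilinear chirp sum. -/
noncomputable def chirpCoeff (L m : ℕ) : ℂ :=
  ∑ u ∈ Finset.range (L - m + 1), ((L : ℂ) - m - u) *
    ∑ v ∈ Finset.range (m + 1), ((m : ℂ) - v) * unitChar (u / (2 * L)) ^ v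

lemma norm_sum_sub_mul_unitChar_pow_le {L m u : ℕ} (hm : m ≤ L) (hu : u ≤ L) (hu0 : 0 < u) :
    ‖∑ v ∈ Finset.range (m + 1), ((m : ℂ) - v) * unitChar (u / (2 * L)) ^ v‖ ≤ L ^ 2 / u := by
  have hL : (0 : ℝ) < L := by exact_mod_cast hu0.trans_le hu
  have hu0' : (0 : ℝ) < u := by exact_mod_cast hu0
  have hu' : (u : ℝ) ≤ L := by exact_mod_cast hu
  have hm' : (m : ℝ) ≤ L := by exact_mod_cast hm
  have h1 := norm_sum_sub_mul_pow_le (norm_unitChar (u / (2 * L))) m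
  have h2 := le_norm_one_sub_unitChar (t := u / (2 * L)) (by positivity) (by
    rw [div_le_div_iff₀ (by positivity) (by norm_num)]
    linarith)
  set X := ‖∑ v ∈ Finset.range (m + 1), ((m : ℂ) - v) * unitChar (u / (2 * L)) ^ v‖
  have h3 : 4 * (u / (2 * L)) * X ≤ 2 * m :=
    (mul_le_mul_of_nonneg_right h2 (norm_nonneg _)).trans h1
  have h4 : 4 * (u / (2 * L)) * X = 2 * (u * X) / L := by
    field_simp
    ring
  rw [h4, div_le_iff₀ hL] at h3
  rw [le_div_iff₀ hu0']
  nlinarith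

lemma norm_chirpCoeff_le {L m : ℕ} (hm : m ≤ L) :
    ‖chirpCoeff L m‖ ≤ L ^ 3 * (1 + ∑ u ∈ Finset.range L, 1 / ((u : ℝ) + 1)) := by
  have hm' : (m : ℝ) ≤ L := by exact_mod_cast hm
  have hw : ∀ u ∈ Finset.range (L - m + 1), ‖(L : ℂ) - m - u‖ ≤ L := by
    intro u hu
    have hu' : u + m ≤ L := by rw [Finset.mem_range] at hu; omega
    rw [show (L : ℂ) - m - u = ((L - (u + m) : ℕ) : ℂ) by push_cast [Nat.cast_sub hu']; ring,
      Complex.norm_natCast]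
    exact_mod_cast Nat.sub_le _ _
  calc ‖chirpCoeff L m‖
      ≤ ∑ u ∈ Finset.range (L - m + 1), L *
        ‖∑ v ∈ Finset.range (m + 1), ((m : ℂ) - v) * unitChar (u / (2 * L)) ^ v‖ := by
        refine (norm_sum_le _ _).trans (Finset.sum_le_sum fun u hu => ?_)
        rw [norm_mul]
        gcongr
        exact hw u hu
    _ ≤ ∑ u ∈ Finset.range (L + 1), L *
        ‖∑ v ∈ Finset.range (m + 1), ((m : ℂ) - v) * unitChar (u / (2 * L)) ^ v‖ := by
        refine Finset.sum_le_sum_of_subset_of_nonneg ?_ fun _ _ _ => by positivity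
        exact Finset.range_subset_range.2 (by omega)
    _ ≤ ∑ u ∈ Finset.range L, L * (L ^ 2 / ((u : ℝ) + 1)) + L * L ^ 2 := by
        rw [Finset.sum_range_succ']
        gcongr with u hu
        · exact_mod_cast norm_sum_sub_mul_unitChar_pow_le hm
            (Nat.succ_le_of_lt (Finset.mem_range.1 hu)) (Nat.succ_pos u)
        · refine (norm_sum_le _ _).trans ?_
          simp only [Nat.cast_zero, zero_div, unitChar_zero, one_pow, mul_one]
          rw [Finset.sum_range_succ, sub_self, norm_zero, add_zero]
          calc ∑ v ∈ Finset.range m, ‖(m : ℂ) - v‖ ≤ ∑ v ∈ Finset.range m, (L : ℝ) := by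
                refine Finset.sum_le_sum fun v hv => ?_
                rw [← Nat.cast_sub (Finset.mem_range.1 hv).le, Complex.norm_natCast]
                exact_mod_cast (Nat.sub_le _ _).trans hm
            _ = m * L := by simp
            _ ≤ L ^ 2 := by nlinarith
    _ = L ^ 3 * (1 + ∑ u ∈ Finset.range L, 1 / ((u : ℝ) + 1)) := by
        rw [mul_add, Finset.mul_sum, add_comm]
        congr 1
        · ring
        · exact Finset.sum_congr rfl fun u _ => by ring

lemma im_sum_sub_mul_unitChar_pow (L m u : ℕ) :
    (∑ v ∈ Finset.range (m + 1), ((m : ℂ) - v) * unitChar (u / (2 * L)) ^ v).im =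
      ∑ v ∈ Finset.range (m + 1), ((m : ℝ) - v) * Real.sin (v * (π * u / L)) := by
  rw [Complex.im_sum]
  refine Finset.sum_congr rfl fun v _ => ?_
  rw [← unitChar_nat_mul, show (m : ℂ) - v = ((m - v : ℝ) : ℂ) by push_cast; ring,
    Complex.im_ofReal_mul, unitChar_im]
  congr 2
  rcases eq_or_ne (L : ℝ) 0 with h | h
  · simp [h]
  · field_simp

lemma im_chirpCoeff (L m : ℕ) :
    (chirpCoeff L m).im = ∑ u ∈ Finset.range (L - m + 1), ((L : ℝ) - m - u) *
      ∑ v ∈ Finset.range (m + 1), ((m : ℝ) - v) * Real.sin (v * (π * u / L)) := by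
  rw [chirpCoeff, Complex.im_sum]
  refine Finset.sum_congr rfl fun u _ => ?_
  rw [← im_sum_sub_mul_unitChar_pow,
    show (L : ℂ) - m - u = ((L - m - u : ℝ) : ℂ) by push_cast; ring, Complex.im_ofReal_mul]

lemma im_chirpCoeff_term_nonneg {L m u : ℕ} (hm : m ≤ L) (hu : u ∈ Finset.range (L - m + 1)) :
    0 ≤ ((L : ℝ) - m - u) *
      ∑ v ∈ Finset.range (m + 1), ((m : ℝ) - v) * Real.sin (v * (π * u / L)) := by
  rw [Finset.mem_range] at hu
  have hu' : (u : ℝ) + m ≤ L := by exact_mod_cast (show u + m ≤ L by omega)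
  refine mul_nonneg (by linarith) (sum_sub_mul_sin_nonneg (by positivity) ?_ m)
  refine div_le_of_le_mul₀ (by positivity) Real.pi_pos.le ?_
  gcongr
  omega

lemma im_chirpCoeff_nonneg {L m : ℕ} (hm : m ≤ L) : 0 ≤ (chirpCoeff L m).im := by
  rw [im_chirpCoeff]
  exact Finset.sum_nonneg fun u hu => im_chirpCoeff_term_nonneg hm hu

lemma le_im_chirpCoeff {J m : ℕ} (hJ : 0 < J) (h1 : 2 * J ≤ m) (h2 : m ≤ 6 * J) :
    (J : ℝ) ^ 3 * ∑ u ∈ Finset.Icc 4 J, 1 / (u : ℝ) ≤ (chirpCoeff (8 * J) m).im := by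
  have hm : m ≤ 8 * J := by omega
  have hJ' : (0 : ℝ) < J := by exact_mod_cast hJ
  have h1' : 2 * (J : ℝ) ≤ m := by exact_mod_cast h1
  have h2' : (m : ℝ) ≤ 6 * J := by exact_mod_cast h2
  rw [im_chirpCoeff]
  refine le_trans ?_ (Finset.sum_le_sum_of_subset_of_nonneg (s := Finset.Icc 4 J)
    (fun u hu => ?_) fun u hu _ => im_chirpCoeff_term_nonneg hm hu)
  · rw [Finset.mul_sum]
    refine Finset.sum_le_sum fun u hu => ?_
    rw [Finset.mem_Icc] at hu
    have hu1 : (4 : ℝ) ≤ u := by exact_mod_cast hu.1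
    have hu2 : (u : ℝ) ≤ J := by exact_mod_cast hu.2
    have hpi := Real.pi_pos
    have hpi2 := Real.pi_lt_d2
    have hθ : π * u / ((8 * J : ℕ) : ℝ) = π * u / (8 * J) := by push_cast; ring
    have key := le_sum_sub_mul_sin (θ := π * u / (8 * J)) (by positivity) (by
      rw [div_le_div_iff₀ (by positivity) (by norm_num)]
      nlinarith) m (by
      rw [← mul_div_assoc, le_div_iff₀ (by positivity)]
      have : 8 * (J : ℝ) ≤ m * u := by nlinarith
      nlinarith)
    rw [hθ]
    calc (J : ℝ) ^ 3 * (1 / u) = J * (J ^ 2 / u) := by ring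
      _ ≤ J * (m / (π * (π * u / (8 * J)))) := by
        refine mul_le_mul_of_nonneg_left ?_ hJ'.le
        rw [show m / (π * (π * u / (8 * J))) = 8 * J * m / (π ^ 2 * u) by field_simp,
          div_le_div_iff₀ (by positivity) (by positivity)]
        have e1 : π ^ 2 ≤ 16 := by nlinarith
        have e2 : J ^ 2 * π ^ 2 ≤ 8 * J * (m : ℝ) := by nlinarith
        nlinarith
      _ ≤ _ := by
        have h0 : (0 : ℝ) ≤ m / (π * (π * u / (8 * J))) := by positivity
        refine mul_le_mul ?_ key h0 ?_
        all_goals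
          push_cast
          linarith
  · rw [Finset.mem_Icc] at hu
    rw [Finset.mem_range]
    omega

/-- Coefficients of a quadratic chirp with weight `diffCount P Q (· - κ)` and phase sign `σ`. -/
noncomputable def chirpWeight (L P Q : ℕ) (κ σ k : ℤ) : ℂ :=
  (diffCount P Q (k - κ) : ℂ) * unitChar (σ * (k : ℝ) ^ 2 / (4 * L))

lemma norm_sum_chirpWeight_le {L P Q : ℕ} (hL : 0 < L) (hP : P ≤ 2 * L) (hQ : Q ≤ 2 * L) {σ : ℤ}
    (hσ : |σ| = 1) (κ : ℤ) (s : Finset ℤ) (hs : Finset.Ioo (κ - Q) (κ + P) ⊆ s) (x d : ℝ) :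
    ‖∑ k ∈ s, chirpWeight L P Q κ σ k * unitChar (x * (3 * k + d))‖ ≤ √(2 * L * P * Q) := by
  have h := norm_sum_diffCount_mul_chirp_le (N := 2 * L) (by omega) hP hQ σ hσ κ s hs (3 * x)
  have e : ∑ k ∈ s, chirpWeight L P Q κ σ k * unitChar (x * (3 * k + d)) =
      unitChar (x * d) * ∑ k ∈ s, (diffCount P Q (k - κ) : ℂ) *
        unitChar (σ * (k : ℝ) ^ 2 / (2 * (2 * L : ℕ)) + 3 * x * k) := by
    rw [Finset.mul_sum]
    refine Finset.sum_congr rfl fun k _ => ?_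
    rw [chirpWeight, unitChar_add, show x * (3 * k + d) = 3 * x * k + x * d by ring,
      unitChar_add]
    push_cast
    rw [show (2 * (2 * (L : ℝ))) = 4 * L by ring]
    ring
  rw [e, norm_mul, norm_unitChar, one_mul]
  exact_mod_cast h

lemma diffCount_of_nonpos {L : ℕ} {j : ℤ} (h0 : j ≤ 0) (h1 : 0 ≤ L + j) :
    diffCount L L j = L + j := by
  rw [diffCount_eq]
  have : ((min (L : ℤ) (L + j) - max 0 j).toNat : ℤ) = L + j := by omega
  exact_mod_cast this

lemma diffCount_of_nonneg {L : ℕ} {j : ℤ} (h0 : 0 ≤ j) (h1 : j ≤ L) :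
    diffCount L L j = L - j := by
  rw [diffCount_eq]
  have : ((min (L : ℤ) (L + j) - max 0 j).toNat : ℤ) = L - j := by omega
  exact_mod_cast this

lemma diffCount_two_mul {L : ℕ} {j : ℤ} (h0 : 0 ≤ j) (h1 : j ≤ L) :
    diffCount (2 * L) L j = L := by
  rw [diffCount_eq]
  have : ((min ((2 * L : ℕ) : ℤ) (L + j) - max 0 j).toNat : ℤ) = L := by
    push_cast
    omega
  exact_mod_cast this

lemma diffCount_eq_zero {L : ℕ} {j : ℤ} (h : L ≤ |j|) : diffCount L L j = 0 := by
  rw [diffCount_eq]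
  have : (min (L : ℤ) (L + j) - max 0 j).toNat = 0 := by
    rcases le_abs.1 h with h | h <;> omega
  exact_mod_cast this

lemma sum_chirpWeight_triple {L : ℕ} (x : ℝ) :
    ∑ k ∈ (Finset.Icc (-L : ℤ) (2 * L) ×ˢ Finset.Icc (-L : ℤ) (2 * L) ×ˢ
        Finset.Icc (-L : ℤ) (2 * L)).filter (fun k => k.1 ≤ k.2.1 ∧ k.2.1 ≤ k.2.2),
      chirpWeight L L L L 1 k.1 * chirpWeight L (2 * L) L 0 (-1) k.2.1 *
        chirpWeight L L L 0 1 k.2.2 * unitChar (3 * x * (k.1 - k.2.1 + k.2.2)) =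
    L * ∑ m ∈ Finset.range (L + 1), chirpCoeff L m *
      unitChar ((m : ℝ) ^ 2 / (4 * L) + 3 * x * m) := by
  rw [← Finset.sum_subset (s₁ := ((Finset.Icc (-L : ℤ) (2 * L) ×ˢ Finset.Icc (-L : ℤ) (2 * L) ×ˢ
      Finset.Icc (-L : ℤ) (2 * L)).filter (fun k => k.1 ≤ k.2.1 ∧ k.2.1 ≤ k.2.2)).filter
      (fun k => 0 ≤ k.1 ∧ k.2.2 ≤ (L : ℤ))) (Finset.filter_subset _ _)]
  · rw [Finset.mul_sum]
    have e : ∀ m ∈ Finset.range (L + 1),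
        (L : ℂ) * (chirpCoeff L m * unitChar ((m : ℝ) ^ 2 / (4 * L) + 3 * x * m)) =
        ∑ q ∈ Finset.range (L - m + 1) ×ˢ Finset.range (m + 1),
          (L : ℂ) * (L - m - q.1) * (m - q.2) * (unitChar (q.1 / (2 * L)) ^ q.2 *
            unitChar ((m : ℝ) ^ 2 / (4 * L) + 3 * x * m)) := by
      intro m _
      rw [chirpCoeff, Finset.sum_product, Finset.sum_mul, Finset.mul_sum]
      refine Finset.sum_congr rfl fun u _ => ?_
      rw [Finset.mul_sum, Finset.sum_mul, Finset.mul_sum]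
      exact Finset.sum_congr rfl fun v _ => by ring
    rw [Finset.sum_congr rfl e, Finset.sum_sigma']
    refine Finset.sum_bij'
      (fun k _ => ⟨(k.1 - k.2.1 + k.2.2).toNat, ((k.2.1 - k.1).toNat, (k.2.2 - k.2.1).toNat)⟩)
      (fun q _ => ((q.1 - q.2.2 : ℤ), (q.1 + q.2.1 - q.2.2 : ℤ), (q.1 + q.2.1 : ℤ)))
      ?_ ?_ ?_ ?_ ?_
    · rintro ⟨p, q, r⟩ hk
      simp at hk ⊢
      omega
    · rintro ⟨m, u, v⟩ hk
      simp at hk ⊢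
      omega
    · rintro ⟨p, q, r⟩ hk
      simp at hk ⊢
      omega
    · rintro ⟨m, u, v⟩ _
      simp
    · rintro ⟨p, q, r⟩ hk
      simp at hk
      obtain ⟨m, hm⟩ : ∃ m : ℕ, (m : ℤ) = p - q + r := ⟨(p - q + r).toNat, by omega⟩
      obtain ⟨u, hu⟩ : ∃ u : ℕ, (u : ℤ) = q - p := ⟨(q - p).toNat, by omega⟩
      obtain ⟨v, hv⟩ : ∃ v : ℕ, (v : ℤ) = r - q := ⟨(r - q).toNat, by omega⟩
      dsimp only
      rw [← hm, ← hu, ← hv, Int.toNat_natCast, Int.toNat_natCast, Int.toNat_natCast]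
      rw [chirpWeight, chirpWeight, chirpWeight, diffCount_of_nonpos (by omega) (by omega),
        diffCount_two_mul (by omega) (by omega), diffCount_of_nonneg (by omega) (by omega)]
      obtain rfl : p = m - v := by omega
      obtain rfl : q = m + u - v := by omega
      obtain rfl : r = m + u := by omega
      rw [← unitChar_nat_mul, ← unitChar_add]
      have hL : unitChar ((v : ℝ) * (u / (2 * L)) + ((m : ℝ) ^ 2 / (4 * L) + 3 * x * m)) =
          unitChar ((1 : ℤ) * ((m - v : ℤ) : ℝ) ^ 2 / (4 * L)) *
          unitChar ((-1 : ℤ) * ((m + u - v : ℤ) : ℝ) ^ 2 / (4 * L)) *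
          unitChar ((1 : ℤ) * ((m + u : ℤ) : ℝ) ^ 2 / (4 * L)) *
          unitChar (3 * x * (((m - v : ℤ) : ℝ) - (m + u - v : ℤ) + (m + u : ℤ))) := by
        rw [← unitChar_add, ← unitChar_add, ← unitChar_add]
        congr 1
        push_cast
        rcases eq_or_ne (L : ℝ) 0 with h | h
        · simp [h]
        · field_simp
          ring
      rw [hL]
      push_cast
      ring
  · rintro ⟨p, q, r⟩ hk hk'
    simp at hk hk'
    dsimp only
    by_cases hp : 0 ≤ p
    · have hr : (L : ℤ) < r := by omega
      have : chirpWeight L L L 0 1 r = 0 := by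
        rw [chirpWeight, diffCount_eq_zero (by rw [le_abs]; omega)]
        simp
      rw [this]
      ring
    · have : chirpWeight L L L L 1 p = 0 := by
        rw [chirpWeight, diffCount_eq_zero (by rw [le_abs]; omega)]
        simp
      rw [this]
      ring

lemma integral_unitChar_mul_int (j : ℤ) :
    ∫ x in (0 : ℝ)..1, unitChar (x * j) = if j = 0 then 1 else 0 := by
  split_ifs with h
  · simp [h, unitChar_zero]
  · have hj : (2 * π * j * I : ℂ) ≠ 0 := by
      have := Real.pi_ne_zero
      simp [h, this]
    have e : ∀ x : ℝ, unitChar (x * j) = Complex.exp ((2 * π * j * I) * x) := by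
      intro x
      rw [unitChar]
      push_cast
      ring_nf
    simp_rw [e]
    rw [integral_exp_mul_complex hj, div_eq_zero_iff]
    left
    have h1 := unitChar_int j
    rw [unitChar] at h1
    push_cast at h1
    rw [show (2 * π * j * I : ℂ) * ((1 : ℝ) : ℂ) = 2 * π * j * I by push_cast; ring, h1]
    simp

lemma integral_sum_mul_conj_sum (M : ℕ) (w d : ℕ → ℂ) (φ : ℕ → ℝ) :
    ∫ x in (0 : ℝ)..1, (∑ m ∈ Finset.range M, w m * unitChar (φ m + 3 * x * m)) *
      starRingEnd ℂ (∑ m ∈ Finset.range M, d m * unitChar (φ m + 3 * x * m)) =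
    ∑ m ∈ Finset.range M, w m * starRingEnd ℂ (d m) := by
  have e : ∀ x : ℝ, (∑ m ∈ Finset.range M, w m * unitChar (φ m + 3 * x * m)) *
      starRingEnd ℂ (∑ m ∈ Finset.range M, d m * unitChar (φ m + 3 * x * m)) =
      ∑ m ∈ Finset.range M, ∑ m' ∈ Finset.range M,
        (w m * starRingEnd ℂ (d m') * unitChar (φ m - φ m')) *
          unitChar (x * ((3 * ((m : ℤ) - m') : ℤ) : ℝ)) := by
    intro x
    rw [map_sum, Finset.sum_mul_sum]
    refine Finset.sum_congr rfl fun m _ => Finset.sum_congr rfl fun m' _ => ?_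
    rw [map_mul, ← unitChar_neg, mul_assoc (w m * _), ← unitChar_add,
      show φ m - φ m' + x * ((3 * ((m : ℤ) - m') : ℤ) : ℝ) =
        (φ m + 3 * x * m) + -(φ m' + 3 * x * m') by push_cast; ring,
      unitChar_add (φ m + 3 * x * m)]
    ring
  have hc : ∀ j : ℤ, Continuous fun x : ℝ => unitChar (x * j) := fun j =>
    continuous_unitChar.comp (continuous_id.mul continuous_const)
  simp_rw [e]
  rw [intervalIntegral.integral_finsetSum]
  swap
  · exact fun m _ => (continuous_finsetSum _ fun m' _ =>
      continuous_const.mul (hc _)).intervalIntegrable _ _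
  refine Finset.sum_congr rfl fun m hm => ?_
  rw [intervalIntegral.integral_finsetSum]
  swap
  · exact fun m' _ => (continuous_const.mul (hc _)).intervalIntegrable _ _
  simp_rw [intervalIntegral.integral_const_mul, integral_unitChar_mul_int]
  rw [Finset.sum_eq_single_of_mem m hm]
  · simp [unitChar_zero]
  · intro m' _ hne
    have : ¬ (3 * ((m : ℤ) - m') = 0) := by omega
    simp [this]

lemma ofReal_le_volume_of_integral {g : ℝ → ℝ} (hg : Continuous g) (h0 : ∀ x, 0 ≤ g x)
    {β Γ : ℝ} (hβ : 0 < β) (hΓ : 0 < Γ) (h1 : 2 * β ≤ ∫ x in (0 : ℝ)..1, g x)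
    (h2 : ∫ x in (0 : ℝ)..1, g x ^ 2 ≤ Γ * β ^ 2) :
    ENNReal.ofReal (1 / (4 * Γ)) ≤ volume (Set.Icc (0 : ℝ) 1 ∩ {x | β ≤ g x}) := by
  set E := Set.Icc (0 : ℝ) 1 ∩ {x | β ≤ g x} with hE
  have hEm : MeasurableSet E :=
    measurableSet_Icc.inter (measurableSet_le measurable_const hg.measurable)
  have hEfin : volume E ≠ ⊤ :=
    ne_top_of_le_ne_top (by simp) (measure_mono (Set.inter_subset_left (s := Set.Icc (0 : ℝ) 1)))
  rw [ENNReal.ofReal_le_iff_le_toReal hEfin]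
  have hT : 0 < 2 * Γ * β := by positivity
  rw [intervalIntegral.integral_of_le zero_le_one, ← integral_Icc_eq_integral_Ioc] at h1 h2
  have hind : Integrable (E.indicator fun _ => 2 * Γ * β) volume :=
    (integrable_indicator_iff hEm).2 (integrableOn_const hEfin)
  have hg2 : IntegrableOn (fun x => g x ^ 2 / (2 * Γ * β)) (Set.Icc 0 1) :=
    ((hg.pow 2).div_const _).integrableOn_Icc
  have hle : ∫ x in Set.Icc (0 : ℝ) 1, g x ≤
      ∫ x in Set.Icc (0 : ℝ) 1, (β + E.indicator (fun _ => 2 * Γ * β) x +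
        g x ^ 2 / (2 * Γ * β)) := by
    refine setIntegral_mono_on hg.integrableOn_Icc ?_ measurableSet_Icc fun x hx => ?_
    · exact ((integrableOn_const (by simp)).add hind.integrableOn).add hg2
    · have hq : 0 ≤ g x ^ 2 / (2 * Γ * β) := by positivity
      by_cases hxE : x ∈ E
      · rw [Set.indicator_of_mem hxE]
        by_cases hbig : g x ≤ 2 * Γ * β
        · linarith
        · have : g x ≤ g x ^ 2 / (2 * Γ * β) := by
            rw [le_div_iff₀ hT, sq]
            exact mul_le_mul_of_nonneg_left (le_of_not_ge hbig) (h0 x)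
          linarith
      · rw [Set.indicator_of_notMem hxE]
        have : g x < β := by
          by_contra hcon
          exact hxE ⟨hx, not_lt.1 hcon⟩
        linarith
  have hval : ∫ x in Set.Icc (0 : ℝ) 1, (β + E.indicator (fun _ => 2 * Γ * β) x +
        g x ^ 2 / (2 * Γ * β)) =
      β + (volume E).toReal * (2 * Γ * β) +
        (∫ x in Set.Icc (0 : ℝ) 1, g x ^ 2) / (2 * Γ * β) := by
    have hi : IntegrableOn (fun x => β + E.indicator (fun _ => 2 * Γ * β) x)
        (Set.Icc (0 : ℝ) 1) := (integrableOn_const (by simp)).add hind.integrableOn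
    rw [integral_add hi hg2,
      integral_add (integrable_const _) hind.integrableOn, integral_div]
    congr 2
    · simp
    · rw [setIntegral_indicator hEm, Set.inter_eq_self_of_subset_right Set.inter_subset_left]
      simp only [integral_const, MeasurableSet.univ, measureReal_restrict_apply, Set.univ_inter,
        smul_eq_mul]
      rfl
  have h3 : (∫ x in Set.Icc (0 : ℝ) 1, g x ^ 2) / (2 * Γ * β) ≤ β / 2 := by
    rw [div_le_iff₀ hT]
    linarith
  rw [div_le_iff₀ (by positivity)]
  have h4 : β * 1 ≤ β * ((volume E).toReal * (4 * Γ)) := by linarith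
  exact le_of_mul_le_mul_left h4 hβ

lemma le_eLpNorm_of_integral {g : ℝ → ℝ} (hg : Continuous g) (h0 : ∀ x, 0 ≤ g x)
    {β Γ c r : ℝ} (hβ : 0 < β) (hΓ : 0 < Γ) (hc : 0 ≤ c) (hr : 0 < r)
    (h1 : 2 * β ≤ ∫ x in (0 : ℝ)..1, g x)
    (h2 : ∫ x in (0 : ℝ)..1, g x ^ 2 ≤ Γ * β ^ 2) {F : ℝ → ℂ}
    (hF : ∀ x ∈ Set.Icc (0 : ℝ) 1, c * g x ≤ ‖F x‖) :
    ENNReal.ofReal (c * β) * ENNReal.ofReal (1 / (4 * Γ)) ^ (1 / r) ≤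
      eLpNorm F (ENNReal.ofReal r) volume := by
  have hvol := ofReal_le_volume_of_integral hg h0 hβ hΓ h1 h2
  set E := Set.Icc (0 : ℝ) 1 ∩ {x | β ≤ g x}
  have hEm : MeasurableSet E :=
    measurableSet_Icc.inter (measurableSet_le measurable_const hg.measurable)
  calc ENNReal.ofReal (c * β) * ENNReal.ofReal (1 / (4 * Γ)) ^ (1 / r)
      ≤ ENNReal.ofReal (c * β) * volume E ^ (1 / r) := by gcongr
    _ = eLpNorm (E.indicator fun _ => c * β) (ENNReal.ofReal r) volume := by
      rw [eLpNorm_indicator_const hEm (by simpa using hr) ENNReal.ofReal_ne_top,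
        ENNReal.toReal_ofReal hr.le, Real.enorm_of_nonneg (by positivity)]
    _ ≤ _ := by
      refine eLpNorm_mono fun x => ?_
      by_cases hx : x ∈ E
      · rw [Set.indicator_of_mem hx, Real.norm_of_nonneg (by positivity)]
        exact (mul_le_mul_of_nonneg_left hx.2 hc).trans (hF x hx.1)
      · rw [Set.indicator_of_notMem hx, norm_zero]
        exact norm_nonneg _

/-- The trigonometric sum with coefficients `chirpCoeff (8 * J)`. -/
noncomputable def chirpSum (J : ℕ) (x : ℝ) : ℂ :=
  ∑ m ∈ Finset.range (8 * J + 1), chirpCoeff (8 * J) m *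
    unitChar ((m : ℝ) ^ 2 / (4 * (8 * J : ℕ)) + 3 * x * m)

lemma continuous_chirpSum (J : ℕ) : Continuous (chirpSum J) := by
  refine continuous_finsetSum _ fun m _ => continuous_const.mul (continuous_unitChar.comp ?_)
  fun_prop

/-- A partial sum of the harmonic series. -/
noncomputable def harmonicTail (J : ℕ) : ℝ := ∑ u ∈ Finset.Icc 4 J, 1 / (u : ℝ)

lemma harmonicTail_nonneg (J : ℕ) : 0 ≤ harmonicTail J :=
  Finset.sum_nonneg fun _ _ => by positivity

lemma norm_sum_diffCount_mul_chirpSum_le {J : ℕ} (hJ : 0 < J) (x : ℝ) :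
    ‖∑ m ∈ Finset.range (8 * J + 1), (diffCount (4 * J) (4 * J) ((m : ℤ) - (4 * J : ℕ)) : ℂ) *
      unitChar ((m : ℝ) ^ 2 / (4 * (8 * J : ℕ)) + 3 * x * m)‖ ≤ 16 * J * √J := by
  have h := norm_sum_diffCount_mul_chirp_le (N := 16 * J) (P := 4 * J) (Q := 4 * J) (by omega)
    (by omega) (by omega) 1 (by simp) ((4 * J : ℕ) : ℤ)
    ((Finset.range (8 * J + 1)).map Nat.castEmbedding) ?_ (3 * x)
  · rw [Finset.sum_map] at h
    refine le_trans (le_of_eq ?_) (h.trans_eq ?_)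
    · congr 1
      refine Finset.sum_congr rfl fun m _ => ?_
      simp only [Nat.castEmbedding_apply, Int.cast_one, Int.cast_natCast]
      congr 3
      push_cast
      ring
    · rw [show (((16 * J : ℕ) : ℝ) * (4 * J : ℕ) * (4 * J : ℕ)) = (16 * J) ^ 2 * J by
        push_cast; ring, Real.sqrt_mul (by positivity), Real.sqrt_sq (by positivity)]
  · intro k hk
    simp only [Finset.mem_Ioo, Finset.mem_map, Finset.mem_range, Nat.castEmbedding_apply] at hk ⊢
    refine ⟨k.toNat, ?_, ?_⟩ <;> omega

lemma le_im_sum_chirpCoeff_mul {J : ℕ} (hJ : 0 < J) :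
    8 * (J : ℝ) ^ 5 * harmonicTail J ≤ (∑ m ∈ Finset.range (8 * J + 1), chirpCoeff (8 * J) m *
      starRingEnd ℂ (diffCount (4 * J) (4 * J) ((m : ℤ) - (4 * J : ℕ)) : ℂ)).im := by
  simp only [Complex.conj_ofReal, Complex.im_sum, Complex.im_mul_ofReal]
  have h0 : ∀ m ∈ Finset.range (8 * J + 1), 0 ≤ (chirpCoeff (8 * J) m).im *
      diffCount (4 * J) (4 * J) ((m : ℤ) - (4 * J : ℕ)) := fun m hm =>
    mul_nonneg (im_chirpCoeff_nonneg (Nat.lt_succ_iff.1 (Finset.mem_range.1 hm)))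
      (Nat.cast_nonneg _)
  have h1 : ∀ m ∈ Finset.Ico (2 * J) (6 * J), (J : ℝ) ^ 3 * harmonicTail J * (2 * J) ≤
      (chirpCoeff (8 * J) m).im * diffCount (4 * J) (4 * J) ((m : ℤ) - (4 * J : ℕ)) := by
    intro m hm
    rw [Finset.mem_Ico] at hm
    have h2 := le_im_chirpCoeff hJ hm.1 hm.2.le
    have h3 : (2 * J : ℝ) ≤ diffCount (4 * J) (4 * J) ((m : ℤ) - (4 * J : ℕ)) := by
      rw [diffCount_eq]
      have : 2 * J ≤ (min ((4 * J : ℕ) : ℤ) ((4 * J : ℕ) + ((m : ℤ) - (4 * J : ℕ))) -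
        max 0 ((m : ℤ) - (4 * J : ℕ))).toNat := by omega
      exact_mod_cast this
    exact mul_le_mul h2 h3 (by positivity) (im_chirpCoeff_nonneg (by omega))
  refine le_trans ?_ (Finset.sum_le_sum_of_subset_of_nonneg (s := Finset.Ico (2 * J) (6 * J))
    (fun m hm => ?_) fun m hm _ => h0 m hm)
  · refine le_trans (le_of_eq ?_) (Finset.card_nsmul_le_sum _ _ _ h1)
    rw [Nat.card_Ico, show 6 * J - 2 * J = 4 * J by omega, nsmul_eq_mul]
    push_cast
    ring
  · rw [Finset.mem_Ico] at hm
    rw [Finset.mem_range]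
    omega

lemma le_integral_norm_chirpSum {J : ℕ} (hJ : 0 < J) :
    (J : ℝ) ^ 3 * √J * harmonicTail J / 2 ≤ ∫ x in (0 : ℝ)..1, ‖chirpSum J x‖ := by
  have h1 := le_im_sum_chirpCoeff_mul hJ
  rw [← integral_sum_mul_conj_sum (8 * J + 1) (chirpCoeff (8 * J)) _
    (fun m => (m : ℝ) ^ 2 / (4 * (8 * J : ℕ)))] at h1
  have h2 : ∫ x in (0 : ℝ)..1, ‖chirpSum J x‖ * (16 * J * √J) =
      (∫ x in (0 : ℝ)..1, ‖chirpSum J x‖) * (16 * J * √J) :=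
    intervalIntegral.integral_mul_const _ _
  have h3 := (h1.trans (Complex.im_le_norm _)).trans
    (intervalIntegral.norm_integral_le_of_norm_le zero_le_one
      (g := fun x => ‖chirpSum J x‖ * (16 * J * √J)) (.of_forall fun x _ => ?_)
      (((continuous_chirpSum J).norm.mul continuous_const).intervalIntegrable _ _))
  · rw [h2] at h3
    have hJ' : (0 : ℝ) < J := by exact_mod_cast hJ
    have hs : √(J : ℝ) * √J = J := Real.mul_self_sqrt hJ'.le
    have hs0 : 0 < √(J : ℝ) := Real.sqrt_pos.2 hJ'
    have h4 : (J : ℝ) ^ 3 * √J * harmonicTail J / 2 * (16 * J * √J) =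
        8 * J ^ 5 * harmonicTail J := by
      calc _ = 8 * (J : ℝ) ^ 4 * (√J * √J) * harmonicTail J := by ring
        _ = _ := by rw [hs]; ring
    rw [← h4] at h3
    exact le_of_mul_le_mul_right h3 (by positivity)
  · rw [norm_mul, RCLike.norm_conj]
    exact mul_le_mul_of_nonneg_left (norm_sum_diffCount_mul_chirpSum_le hJ x) (norm_nonneg _)

lemma integral_sq_norm_chirpSum (J : ℕ) :
    ∫ x in (0 : ℝ)..1, ‖chirpSum J x‖ ^ 2 =
      ∑ m ∈ Finset.range (8 * J + 1), ‖chirpCoeff (8 * J) m‖ ^ 2 := by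
  have h := integral_sum_mul_conj_sum (8 * J + 1) (chirpCoeff (8 * J)) (chirpCoeff (8 * J))
    (fun m => (m : ℝ) ^ 2 / (4 * (8 * J : ℕ)))
  simp_rw [Complex.mul_conj, Complex.normSq_eq_norm_sq] at h
  rw [intervalIntegral.integral_ofReal] at h
  unfold chirpSum
  exact_mod_cast h

lemma log_sub_two_le_harmonicTail (J : ℕ) : Real.log J - 2 ≤ harmonicTail J := by
  have h1 := log_add_one_le_harmonic J
  have h2 : (harmonic J : ℝ) ≤ 2 + harmonicTail J := by
    rw [harmonic_eq_sum_Icc, harmonicTail]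
    push_cast
    have : ∑ u ∈ Finset.Icc 1 J, ((u : ℝ))⁻¹ ≤
        ∑ u ∈ Finset.Icc 1 3 ∪ Finset.Icc 4 J, ((u : ℝ))⁻¹ :=
      Finset.sum_le_sum_of_subset_of_nonneg (fun u hu => by simp at hu ⊢; omega)
        fun _ _ _ => by positivity
    refine this.trans ?_
    rw [Finset.sum_union]
    · simp only [one_div]
      gcongr
      norm_num [Finset.sum_Icc_succ_top]
    · rw [Finset.disjoint_left]
      intro u h h'
      simp at h h'
      omega
  rcases Nat.eq_zero_or_pos J with rfl | hJ
  · simp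
    linarith [harmonicTail_nonneg 0]
  · have h3 : Real.log J ≤ Real.log (J + 1 : ℕ) :=
      Real.log_le_log (by exact_mod_cast hJ) (by push_cast; linarith)
    linarith

lemma one_add_sum_le_harmonicTail {J : ℕ} (hJ : 9 ≤ Real.log J) :
    1 + ∑ u ∈ Finset.range (8 * J), 1 / ((u : ℝ) + 1) ≤ 2 * harmonicTail J := by
  have hJ0 : (J : ℝ) ≠ 0 := by
    rintro h
    rw [h, Real.log_zero] at hJ
    norm_num at hJ
  have h1 := harmonic_le_one_add_log (8 * J)
  have h2 : (harmonic (8 * J) : ℝ) = ∑ u ∈ Finset.range (8 * J), 1 / ((u : ℝ) + 1) := by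
    simp [harmonic]
  have h3 : Real.log (8 * J : ℕ) = 3 * Real.log 2 + Real.log J := by
    push_cast
    rw [Real.log_mul (by norm_num) hJ0, show (8 : ℝ) = 2 ^ 3 by norm_num, Real.log_pow]
    norm_num
  have h4 := log_sub_two_le_harmonicTail J
  have h5 := Real.log_two_lt_d9
  linarith

lemma integral_sq_norm_chirpSum_le {J : ℕ} (hJ : 9 ≤ Real.log J) :
    ∫ x in (0 : ℝ)..1, ‖chirpSum J x‖ ^ 2 ≤
      9 * 512 ^ 2 * 64 * ((J : ℝ) ^ 3 * √J * harmonicTail J / 4) ^ 2 := by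
  have hJ1 : (1 : ℝ) ≤ J := by
    rcases Nat.eq_zero_or_pos J with rfl | h
    · norm_num at hJ
    · exact_mod_cast h
  have h0 := harmonicTail_nonneg J
  have h1 : ∀ m ∈ Finset.range (8 * J + 1), ‖chirpCoeff (8 * J) m‖ ^ 2 ≤
      (((8 * J : ℕ) : ℝ) ^ 3 * (2 * harmonicTail J)) ^ 2 := by
    intro m hm
    have := norm_chirpCoeff_le (Nat.lt_succ_iff.1 (Finset.mem_range.1 hm))
    have h2 := one_add_sum_le_harmonicTail hJ
    gcongr
    exact this.trans (by gcongr)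
  rw [integral_sq_norm_chirpSum]
  refine (Finset.sum_le_card_nsmul _ _ _ h1).trans ?_
  rw [Finset.card_range, nsmul_eq_mul]
  push_cast
  have hs : √(J : ℝ) ^ 2 = J := Real.sq_sqrt (by linarith)
  calc (8 * (J : ℝ) + 1) * ((8 * J) ^ 3 * (2 * harmonicTail J)) ^ 2
      ≤ (9 * J) * ((8 * J) ^ 3 * (2 * harmonicTail J)) ^ 2 := by
        gcongr
        linarith
    _ = 9 * 512 ^ 2 * 64 * (J ^ 6 * √J ^ 2 * harmonicTail J ^ 2 / 16) := by
        rw [hs]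
        ring
    _ = _ := by ring

/-- The index sets of the wave packets used in the counterexample. -/
noncomputable def packetIndices (m L i : ℕ) : Finset ℤ :=
  if i < m then {0} else Finset.Icc (-L : ℤ) (2 * L)

/-- The frequencies of the wave packets used in the counterexample. -/
noncomputable def packetFreq (m L i : ℕ) (k : ℤ) : ℤ :=
  if i < m then i - m - 3 * L else 3 * k + (i - m)

/-- The coefficients of the wave packets used in the counterexample. -/
noncomputable def packetWeight (m L i : ℕ) (k : ℤ) : ℂ :=
  if i < m then 1 else if i = m then chirpWeight L L L L 1 k else
    if i = m + 1 then chirpWeight L (2 * L) L 0 (-1) k else chirpWeight L L L 0 1 k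

lemma packetFreq_ne {m L i j : ℕ} (hij : i ≠ j) (hi : i < m + 3) (hj : j < m + 3) {k k' : ℤ}
    (hk : k ∈ packetIndices m L i) (hk' : k' ∈ packetIndices m L j) :
    packetFreq m L i k ≠ packetFreq m L j k' := by
  unfold packetFreq
  unfold packetIndices at hk hk'
  split_ifs at hk hk' ⊢ <;> simp at hk hk' <;> omega

lemma strictMono_packetFreq_iff {m L : ℕ} {k : Fin (m + 3) → ℤ}
    (hk : ∀ i : Fin (m + 3), k i ∈ packetIndices m L i) :
    (StrictMono fun i : Fin (m + 3) => packetFreq m L i (k i)) ↔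
      k ⟨m, by omega⟩ ≤ k ⟨m + 1, by omega⟩ ∧ k ⟨m + 1, by omega⟩ ≤ k ⟨m + 2, by omega⟩ := by
  constructor
  · intro h
    have h1 := h (show (⟨m, by omega⟩ : Fin (m + 3)) < ⟨m + 1, by omega⟩ from
      Fin.mk_lt_mk.2 (by omega))
    have h2 := h (show (⟨m + 1, by omega⟩ : Fin (m + 3)) < ⟨m + 2, by omega⟩ from
      Fin.mk_lt_mk.2 (by omega))
    simp [packetFreq] at h1 h2
    omega
  · rintro ⟨h1, h2⟩
    rw [Fin.strictMono_iff_lt_succ]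
    rintro ⟨i, hi⟩
    have h3 := hk ⟨i + 1, by omega⟩
    simp only [Fin.castSucc_mk, Fin.succ_mk, packetFreq]
    unfold packetIndices at h3
    rcases lt_trichotomy i m with h | rfl | h
    · split_ifs at h3 ⊢ <;> simp at h3 <;> push_cast <;> omega
    · simp
      omega
    · obtain rfl : i = m + 1 := by omega
      have h4 : k ⟨m + 1, by omega⟩ ≤ k ⟨m + 1 + 1, by omega⟩ := h2
      simp
      omega

open Classical in
lemma sum_packetWeight (m L : ℕ) (x : ℝ) :
    ∑ k ∈ (Fintype.piFinset fun i : Fin (m + 3) => packetIndices m L i).filter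
        (fun k => StrictMono fun i : Fin (m + 3) => packetFreq m L i (k i)),
      (∏ i : Fin (m + 3), packetWeight m L i (k i)) *
        unitChar (x * ∑ i : Fin (m + 3),
          (if (i : ℕ) = m + 3 - 2 then (-1 : ℝ) else 1) * packetFreq m L i (k i)) =
    unitChar (x * (∑ i : Fin m, ((i : ℝ) - m - 3 * L) + 1)) *
      (L * ∑ u ∈ Finset.range (L + 1), chirpCoeff L u *
        unitChar ((u : ℝ) ^ 2 / (4 * L) + 3 * x * u)) := by
  rw [← sum_chirpWeight_triple, Finset.mul_sum]
  refine Finset.sum_bij'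
    (fun k _ => (k ⟨m, by omega⟩, k ⟨m + 1, by omega⟩, k ⟨m + 2, by omega⟩))
    (fun q _ i => if (i : ℕ) < m then 0 else if (i : ℕ) = m then q.1 else
      if (i : ℕ) = m + 1 then q.2.1 else q.2.2) ?_ ?_ ?_ ?_ ?_
  · intro k hk
    rw [Finset.mem_filter, Fintype.mem_piFinset] at hk
    have h := (strictMono_packetFreq_iff hk.1).1 hk.2
    have h1 := hk.1 ⟨m, by omega⟩
    have h2 := hk.1 ⟨m + 1, by omega⟩
    have h3 := hk.1 ⟨m + 2, by omega⟩
    simp only [packetIndices, lt_irrefl, if_false, show ¬ m + 1 < m by omega,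
      show ¬ m + 2 < m by omega] at h1 h2 h3
    simp only [Finset.mem_filter, Finset.mem_product]
    exact ⟨⟨h1, h2, h3⟩, h⟩
  · rintro ⟨a, b, c⟩ hq
    simp only [Finset.mem_filter, Finset.mem_product] at hq
    have hmem : ∀ i : Fin (m + 3), (if (i : ℕ) < m then 0 else if (i : ℕ) = m then a else
        if (i : ℕ) = m + 1 then b else c) ∈ packetIndices m L i := by
      intro i
      unfold packetIndices
      split_ifs
      · simp
      · exact hq.1.1
      · exact hq.1.2.1
      · exact hq.1.2.2
    rw [Finset.mem_filter, Fintype.mem_piFinset]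
    refine ⟨hmem, (strictMono_packetFreq_iff hmem).2 ?_⟩
    simpa using hq.2
  · intro k hk
    rw [Finset.mem_filter, Fintype.mem_piFinset] at hk
    ext ⟨i, hi⟩
    have h1 := hk.1 ⟨i, hi⟩
    simp only [packetIndices] at h1
    dsimp only
    split_ifs with ha hb hc
    · rw [if_pos ha, Finset.mem_singleton] at h1
      exact h1.symm
    · simp [hb]
    · simp [hc]
    · obtain rfl : i = m + 2 := by omega
      rfl
  · rintro ⟨a, b, c⟩ _
    simp
  · intro k _
    simp only [Fin.prod_univ_castSucc, Fin.sum_univ_castSucc]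
    have e1 : (Fin.last m).castSucc.castSucc = (⟨m, by omega⟩ : Fin (m + 3)) := rfl
    have e2 : (Fin.last (m + 1)).castSucc = (⟨m + 1, by omega⟩ : Fin (m + 3)) := rfl
    have e3 : Fin.last (m + 2) = (⟨m + 2, by omega⟩ : Fin (m + 3)) := rfl
    rw [e1, e2, e3]
    have h1 : ∀ i : Fin m, packetWeight m L (i.castSucc.castSucc.castSucc : Fin (m + 3))
        (k i.castSucc.castSucc.castSucc) = 1 := fun i => by simp [packetWeight]
    have h2 : ∀ i : Fin m,
        (if ((i.castSucc.castSucc.castSucc : Fin (m + 3)) : ℕ) = m + 3 - 2 then (-1 : ℝ) else 1) *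
        packetFreq m L (i.castSucc.castSucc.castSucc : Fin (m + 3))
          (k i.castSucc.castSucc.castSucc) = (i : ℝ) - m - 3 * L := fun i => by
      have : (i : ℕ) ≠ m + 1 := by omega
      simp [packetFreq, this]
    simp_rw [h1, h2]
    have h3 : (if m = m + 3 - 2 then (-1 : ℝ) else 1) = 1 := if_neg (by omega)
    have h4 : (if m + 1 = m + 3 - 2 then (-1 : ℝ) else 1) = -1 := if_pos (by omega)
    have h5 : (if m + 2 = m + 3 - 2 then (-1 : ℝ) else 1) = 1 := if_neg (by omega)
    simp only [h3, h4, h5, packetWeight, packetFreq, lt_irrefl, if_false, if_true,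
      show ¬ m + 1 < m by omega, show ¬ m + 2 < m by omega, show ¬ m + 1 = m by omega,
      show ¬ m + 2 = m by omega, show ¬ m + 2 = m + 1 by omega, Finset.prod_const_one, one_mul]
    rw [mul_left_comm (unitChar _), ← unitChar_add]
    congr 2
    push_cast
    ring

lemma norm_sum_packetWeight_le {m i J : ℕ} (hJ : 0 < J) (x : ℝ) :
    ‖∑ k ∈ packetIndices m (8 * J) i,
      packetWeight m (8 * J) i k * unitChar (x * packetFreq m (8 * J) i k)‖ ≤
      if i < m then 1 else 48 * J * √J := by
  have hbd : ∀ P Q : ℕ, P * Q ≤ 2 * (8 * J) ^ 2 →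
      √(2 * (8 * J : ℕ) * P * Q) ≤ 48 * J * √J := by
    intro P Q hPQ
    have hPQ' : (P : ℝ) * Q ≤ 2 * (8 * J) ^ 2 := by exact_mod_cast hPQ
    have hJ' : (0 : ℝ) < J := by exact_mod_cast hJ
    have hs : √(J : ℝ) ^ 2 = J := Real.sq_sqrt hJ'.le
    refine Real.sqrt_le_iff.2 ⟨by positivity, ?_⟩
    calc (2 * (8 * J : ℕ) * P * Q : ℝ) = 16 * J * (P * Q) := by push_cast; ring
      _ ≤ 16 * J * (2 * (8 * J) ^ 2) := by gcongr
      _ ≤ 2304 * J ^ 3 := by nlinarith [pow_pos hJ' 3]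
      _ = (48 * J) ^ 2 * √J ^ 2 := by rw [hs]; ring
      _ = _ := by ring
  unfold packetIndices packetWeight packetFreq
  split_ifs with h1 h2 h3
  · simp [norm_unitChar]
  all_goals
    push_cast only [Int.cast_add, Int.cast_mul, Int.cast_sub, Int.cast_natCast, Int.cast_ofNat]
  · refine (norm_sum_chirpWeight_le (by omega) (by omega) (by omega) (by simp) _ _ ?_ x _).trans
      (hbd _ _ (by nlinarith))
    intro k hk
    simp only [Finset.mem_Ioo, Finset.mem_Icc] at hk ⊢
    omega
  · refine (norm_sum_chirpWeight_le (by omega) (by omega) (by omega) (by simp) _ _ ?_ x _).trans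
      (hbd _ _ (by nlinarith))
    intro k hk
    simp only [Finset.mem_Ioo, Finset.mem_Icc] at hk ⊢
    omega
  · refine (norm_sum_chirpWeight_le (by omega) (by omega) (by omega) (by simp) _ _ ?_ x _).trans
      (hbd _ _ (by nlinarith))
    intro k hk
    simp only [Finset.mem_Ioo, Finset.mem_Icc] at hk ⊢
    omega

lemma eLpNorm_window_ne_top (p : ℝ≥0∞) : eLpNorm window p volume ≠ ⊤ := by
  obtain ⟨f, -, -, hf⟩ := exists_wavePacketSum ({0} : Finset ℤ) (fun _ => 1) id
  have : window = f := by
    ext x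
    simp [hf, unitChar_zero]
  rw [this]
  exact (f.memLp p volume).2.ne

lemma exists_packets (m : ℕ) {J : ℕ} (hJ : 0 < J) :
    ∃ f : Fin (m + 3) → SchwartzMap ℝ ℂ, (∀ i, HasCompactSupport (𝓕 ⇑(f i))) ∧
      (∀ (i : Fin (m + 3)) (q : ℝ≥0∞), eLpNorm (f i) q volume ≤
        ENNReal.ofReal (if (i : ℕ) < m then 1 else 48 * J * √J) * eLpNorm window q volume) ∧
      ∀ x, ‖Cop (fun i : Fin (m + 3) => if (i : ℕ) = m + 3 - 2 then (-1 : ℝ) else 1)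
        (fun i => ⇑(f i)) x‖ =
        (∏ i : Fin (m + 3), ‖window (x * if (i : ℕ) = m + 3 - 2 then (-1 : ℝ) else 1)‖) *
          (8 * J * ‖chirpSum J x‖) := by
  choose f hf1 hf2 hf3 using fun i : Fin (m + 3) => exists_wavePacketSum
    (packetIndices m (8 * J) i) (packetWeight m (8 * J) i) (packetFreq m (8 * J) i)
  refine ⟨f, hf1, fun i q => ?_, fun x => ?_⟩
  · refine eLpNorm_le_mul_eLpNorm_of_ae_le_mul (.of_forall fun x => ?_) _
    rw [hf3, norm_mul]
    exact mul_le_mul_of_nonneg_right (norm_sum_packetWeight_le hJ x) (norm_nonneg _)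
  · rw [Cop_wavePacketSum _ (fun i : Fin (m + 3) => packetIndices m (8 * J) i)
      (fun i : Fin (m + 3) => packetWeight m (8 * J) i)
      (fun i : Fin (m + 3) => packetFreq m (8 * J) i) _ hf2
      (fun i j hij k hk k' hk' => packetFreq_ne (fun h => hij (Fin.ext h)) i.2 j.2 hk hk'),
      sum_packetWeight, norm_mul, norm_mul, norm_unitChar, one_mul, norm_mul, norm_prod,
      chirpSum]
    simp

theorem exists_lt_eLpNorm_Cop (m : ℕ) (p : Fin (m + 3) → ℝ) (hp : ∀ i, 1 ≤ p i)
    (C : ℝ) (hC : 0 < C) :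
    ∃ f : Fin (m + 3) → SchwartzMap ℝ ℂ,
      (∀ i, HasCompactSupport (𝓕 ⇑(f i))) ∧
      ENNReal.ofReal C * ∏ i, eLpNorm ⇑(f i) (ENNReal.ofReal (p i)) volume <
        eLpNorm
          (Cop (fun i : Fin (m + 3) => if (i : ℕ) = m + 3 - 2 then (-1 : ℝ) else 1)
            (fun i => ⇑(f i)))
          (ENNReal.ofReal (1 / ∑ i, 1 / p i)) volume := by
  obtain ⟨c, hc, hcw⟩ := exists_le_norm_window
  set r : ℝ := 1 / ∑ i, 1 / p i with hr
  have hr0 : 0 < r := by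
    refine one_div_pos.2 (Finset.sum_pos (fun i _ => ?_) ⟨0, Finset.mem_univ _⟩)
    exact one_div_pos.2 (zero_lt_one.trans_le (hp i))
  set A : ℝ≥0∞ := ∏ i, eLpNorm window (ENNReal.ofReal (p i)) volume with hA
  have hAtop : A ≠ ⊤ := ENNReal.prod_ne_top fun i _ => eLpNorm_window_ne_top _
  set b : ℝ := (1 / (4 * (9 * 512 ^ 2 * 64))) ^ (1 / r) with hb
  have hb0 : 0 < b := by positivity
  have hbE : ENNReal.ofReal (1 / (4 * (9 * 512 ^ 2 * 64))) ^ (1 / r) = ENNReal.ofReal b :=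
    ENNReal.ofReal_rpow_of_pos (by positivity)
  have hD : 0 < c ^ (m + 3) * 2 * b := by positivity
  have hlog := Real.tendsto_log_atTop.comp (tendsto_natCast_atTop_atTop (R := ℝ))
  obtain ⟨J, hJ9, hJC⟩ := ((hlog.eventually_ge_atTop 9).and (hlog.eventually_gt_atTop
    (2 + C * 48 ^ 3 * A.toReal / (c ^ (m + 3) * 2 * b)))).exists
  simp only [Function.comp_apply] at hJ9 hJC
  have hJ : 0 < J := by
    rcases Nat.eq_zero_or_pos J with rfl | h
    · norm_num at hJ9
    · exact h
  have hJ' : (0 : ℝ) < J := by exact_mod_cast hJ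
  have hs : √(J : ℝ) ^ 2 = J := Real.sq_sqrt hJ'.le
  have hs0 : 0 < √(J : ℝ) := Real.sqrt_pos.2 hJ'
  have hh := log_sub_two_le_harmonicTail J
  have hh0 : 0 < harmonicTail J := by linarith
  have hmain : C * 48 ^ 3 * A.toReal < c ^ (m + 3) * 2 * b * harmonicTail J := by
    rw [← div_lt_iff₀' hD]
    linarith
  obtain ⟨f, hf1, hf2, hf3⟩ := exists_packets m hJ
  refine ⟨f, hf1, ?_⟩
  have hlow := le_eLpNorm_of_integral (continuous_chirpSum J).norm (fun x => norm_nonneg _)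
    (β := (J : ℝ) ^ 3 * √J * harmonicTail J / 4) (Γ := 9 * 512 ^ 2 * 64)
    (c := c ^ (m + 3) * (8 * J)) (by positivity) (by norm_num) (by positivity) hr0
    (by linarith [le_integral_norm_chirpSum hJ]) (integral_sq_norm_chirpSum_le hJ9)
    (F := Cop (fun i : Fin (m + 3) => if (i : ℕ) = m + 3 - 2 then (-1 : ℝ) else 1)
            (fun i => ⇑(f i))) (fun x hx => by
      rw [hf3, mul_assoc]
      refine mul_le_mul_of_nonneg_right ?_ (by positivity)
      refine le_trans (le_of_eq (by simp))
        (Finset.prod_le_prod (f := fun _ : Fin (m + 3) => c) (fun _ _ => hc.le) fun i _ => hcw _ ?_)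
      have : |x| ≤ 1 := abs_le.2 ⟨by linarith [hx.1], hx.2⟩
      split_ifs <;> simpa using this)
  refine lt_of_lt_of_le ?_ hlow
  rw [hbE, ← ENNReal.ofReal_mul (by positivity)]
  have hup : ∏ i, eLpNorm ⇑(f i) (ENNReal.ofReal (p i)) volume ≤
      ENNReal.ofReal ((48 * J * √J) ^ 3) * A := by
    refine (Finset.prod_le_prod' fun i _ => hf2 i _).trans_eq ?_
    rw [Finset.prod_mul_distrib, ENNReal.ofReal_pow (by positivity)]
    congr 1
    simp only [Fin.prod_univ_castSucc]
    simp
    ring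
  refine (mul_le_mul_right hup _).trans_lt ?_
  rw [← ENNReal.ofReal_toReal hAtop, ← ENNReal.ofReal_mul (by positivity),
    ← ENNReal.ofReal_mul hC.le, ENNReal.ofReal_lt_ofReal_iff (by positivity)]
  calc C * ((48 * J * √J) ^ 3 * A.toReal)
      = (J ^ 3 * √J ^ 2 * √J) * (C * 48 ^ 3 * A.toReal) := by ring
    _ < (J ^ 3 * √J ^ 2 * √J) * (c ^ (m + 3) * 2 * b * harmonicTail J) := by gcongr
    _ = (J ^ 3 * J * √J) * (c ^ (m + 3) * 2 * b * harmonicTail J) := by rw [hs]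
    _ = _ := by ring

/-- `C_n^ε` with the sign pattern `(1,…,1,-1,1)` (the `-1` at the
next-to-last position, i.e. `0`-based index `n-2`) is unbounded for all `p_i ≥ 1`. -/
theorem stmt8 (n : ℕ) (hn : 3 ≤ n) (p : Fin n → ℝ) (hp : ∀ i, 1 ≤ p i)
    (C : ℝ) (hC : 0 < C) :
    ∃ f : Fin n → SchwartzMap ℝ ℂ,
      (∀ i, HasCompactSupport (𝓕 ⇑(f i))) ∧
      ENNReal.ofReal C * ∏ i, eLpNorm ⇑(f i) (ENNReal.ofReal (p i)) volume <
        eLpNorm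
          (Cop (fun i : Fin n => if (i : ℕ) = n - 2 then (-1 : ℝ) else 1)
            (fun i => ⇑(f i)))
          (ENNReal.ofReal (1 / ∑ i, 1 / p i)) volume := by
  obtain ⟨m, rfl⟩ : ∃ m, n = m + 3 := ⟨n - 3, by omega⟩
  exact exists_lt_eLpNorm_Cop m p hp C hC
end

section
/- Let p_1, p_2, p_3 > 1 with p_3 < 2. Then the Biest operator C_3^{(1,1,1)} satisfies no estimate of the form L^{p_1} × L^{p_2} × W_{p_3} → L^{1/(1/p_1+1/p_2+1/p_3)}: for every constant C > 0 there exist Schwartz functions f, g, h with compactly supported Fourier transforms such that ‖C_3^{(1,1,1)}(f,g,h)‖_{L^{1/(1/p_1+1/p_2+1/p_3)}(ℝ)} > C ‖f‖_{L^{p_1}} ‖g‖_{L^{p_2}} ‖ĥ‖_{L^{p_3′}}. -/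
open MeasureTheory Complex
open scoped FourierTransform Real ENNReal

/-- Frequency-ordered inputs: the simplex constraint is void and `Cop` is a pointwise product. -/
lemma Cop_eq_mul_of_support (f g h : SchwartzMap ℝ ℂ) {a b : ℝ}
    (hf : ∀ ξ, 𝓕 ⇑f ξ ≠ 0 → ξ < a) (hg : ∀ ξ, 𝓕 ⇑g ξ ≠ 0 → a < ξ ∧ ξ < b)
    (hh : ∀ ξ, 𝓕 ⇑h ξ ≠ 0 → b < ξ) (x : ℝ) :
    Cop ![(1 : ℝ), 1, 1] ![⇑f, ⇑g, ⇑h] x = f x * g x * h x := by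
  have inv : ∀ u : SchwartzMap ℝ ℂ,
      ∫ t : ℝ, 𝓕 ⇑u t * cexp (2 * π * I * x * t) = u x := by
    intro u
    have h1 : 𝓕⁻ (𝓕 u) = u := FourierTransform.fourierInv_fourier_eq u
    conv_rhs => rw [← h1]
    rw [SchwartzMap.fourierInv_coe, SchwartzMap.fourier_coe, Real.fourierInv_eq']
    congr 1 with t
    simp only [RCLike.inner_apply, conj_trivial, smul_eq_mul, ofReal_mul, ofReal_ofNat]
    rw [mul_comm]
    congr 2
    ring
  unfold Cop
  rw [setIntegral_eq_integral_of_forall_compl_eq_zero]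
  · have key := integral_fintype_prod_volume_eq_prod (ι := Fin 3) (E := fun _ ↦ ℝ)
      (fun i t ↦ 𝓕 ((![⇑f, ⇑g, ⇑h] : Fin 3 → ℝ → ℂ) i) t * cexp (2 * π * I * x * t))
    rw [Fin.prod_univ_three (f := fun i ↦ ∫ t : ℝ, _)] at key
    simp only [Matrix.cons_val_zero, Matrix.cons_val_one, Matrix.cons_val, inv] at key
    rw [← key]
    congr 1 with t
    simp only [Finset.prod_mul_distrib, ← Complex.exp_sum, Fin.sum_univ_three, Matrix.cons_val_zero,
      Matrix.cons_val_one, Matrix.cons_val]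
    congr 2
    push_cast
    ring
  · intro t ht
    by_contra hne
    apply ht
    have hne := left_ne_zero_of_mul hne
    rw [Fin.prod_univ_three] at hne
    have h2 : 𝓕 ⇑h (t 2) ≠ 0 := right_ne_zero_of_mul hne
    have h1 : 𝓕 ⇑g (t 1) ≠ 0 := right_ne_zero_of_mul (left_ne_zero_of_mul hne)
    have h0 : 𝓕 ⇑f (t 0) ≠ 0 := left_ne_zero_of_mul (left_ne_zero_of_mul hne)
    have := hf _ h0
    have := hg _ h1
    have := hh _ h2
    rw [Set.mem_ofPred_eq, Fin.strictMono_iff_lt_succ]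
    intro i
    fin_cases i <;> simp <;> linarith

/-- Wave packets: modulated, dilated and translated copies of `𝓕⁻ φ`. -/
lemma exists_wavePacket (φ : SchwartzMap ℝ ℂ) (hφ : HasCompactSupport φ) {a : ℝ} (ha : 0 < a)
    (b c : ℝ) :
    ∃ W : SchwartzMap ℝ ℂ, (∀ x, W x = cexp (2 * π * I * b * x) * 𝓕⁻ φ (a * x - c)) ∧
      ∀ ξ, 𝓕 ⇑W ξ = a⁻¹ * cexp (-(2 * π * I * c * ((ξ - b) / a : ℝ))) * φ ((ξ - b) / a) := by
  let u : ℝ → ℂ := fun ξ ↦ a⁻¹ * cexp (-(2 * π * I * c * ((ξ - b) / a : ℝ))) * φ ((ξ - b) / a)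
  have huc : HasCompactSupport u := by
    refine HasCompactSupport.mul_left ?_
    have : HasCompactSupport (⇑φ ∘ ((Homeomorph.subRight b).trans
        (Homeomorph.mulRight₀ a⁻¹ (inv_ne_zero ha.ne')))) := hφ.comp_homeomorph _
    simpa [Function.comp_def, div_eq_mul_inv] using this
  have hus : ContDiff ℝ (⊤ : ℕ∞) u := by
    have h1 : ContDiff ℝ (⊤ : ℕ∞) (fun ξ : ℝ ↦ (ξ - b) / a) := by fun_prop
    have h2 : ContDiff ℝ (⊤ : ℕ∞) (fun ξ : ℝ ↦ (((ξ - b) / a : ℝ) : ℂ)) :=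
      ofRealCLM.contDiff.comp h1
    have h3 : ContDiff ℝ (⊤ : ℕ∞) (fun ξ : ℝ ↦ φ ((ξ - b) / a)) := (φ.smooth _).comp h1
    fun_prop
  let U : SchwartzMap ℝ ℂ := huc.toSchwartzMap hus
  have hU : ⇑U = u := rfl
  refine ⟨𝓕⁻ U, fun x ↦ ?_, fun ξ ↦ ?_⟩
  · rw [SchwartzMap.fourierInv_coe, hU, SchwartzMap.fourierInv_coe, Real.fourierInv_eq',
      Real.fourierInv_eq']
    simp only [RCLike.inner_apply, conj_trivial, smul_eq_mul]
    let G : ℝ → ℂ := fun y ↦ a⁻¹ * (cexp (2 * π * I * b * x) *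
      (cexp ((2 * π * ((a * x - c) * y) : ℝ) * I) * φ y))
    have hG : ∀ ξ : ℝ, cexp ((2 * π * (x * ξ) : ℝ) * I) * u ξ = G ((ξ - b) / a) := by
      intro ξ
      simp only [u, G]
      have : cexp ((2 * π * (x * ξ) : ℝ) * I) * cexp (-(2 * π * I * c * ((ξ - b) / a : ℝ)))
        = cexp (2 * π * I * b * x) * cexp ((2 * π * ((a * x - c) * ((ξ - b) / a)) : ℝ) * I) := by
        rw [← Complex.exp_add, ← Complex.exp_add]
        congr 1
        have : (a : ℂ) ≠ 0 := by exact_mod_cast ha.ne'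
        push_cast
        field_simp
        ring
      linear_combination ((a⁻¹ : ℝ) : ℂ) * φ ((ξ - b) / a) * this
    simp_rw [hG]
    rw [integral_sub_right_eq_self (fun ξ ↦ G (ξ / a)) b, Measure.integral_comp_div]
    simp only [G]
    rw [integral_const_mul, integral_const_mul, abs_of_pos ha, real_smul, ← mul_assoc]
    rw [← ofReal_mul, mul_inv_cancel₀ ha.ne', ofReal_one, one_mul]
  · rw [← SchwartzMap.fourier_coe, FourierTransform.fourier_fourierInv_eq]
    rfl

lemma exists_bump_profile : ∃ φ : SchwartzMap ℝ ℂ, HasCompactSupport φ ∧ (∀ ξ, ‖φ ξ‖ ≤ 1) ∧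
    (∀ ξ, φ ξ ≠ 0 → 0 < ξ ∧ ξ < 1) ∧ 𝓕⁻ φ 0 ≠ 0 := by
  let β : ContDiffBump (1 / 2 : ℝ) := ⟨1 / 4, 1 / 2, by norm_num, by norm_num⟩
  have hc : HasCompactSupport (fun x ↦ (β x : ℂ)) :=
    β.hasCompactSupport.comp_left (g := fun y : ℝ ↦ (y : ℂ)) (by simp)
  have hs : ContDiff ℝ (⊤ : ℕ∞) (fun x ↦ (β x : ℂ)) := ofRealCLM.contDiff.comp β.contDiff
  refine ⟨hc.toSchwartzMap hs, hc, fun ξ ↦ ?_, fun ξ hξ ↦ ?_, ?_⟩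
  · change ‖(β ξ : ℂ)‖ ≤ 1
    rw [norm_real, Real.norm_eq_abs, abs_of_nonneg β.nonneg]
    exact β.le_one
  · change (β ξ : ℂ) ≠ 0 at hξ
    have : ξ ∈ Function.support β := by simpa using hξ
    rw [β.support_eq, Real.ball_eq_Ioo] at this
    obtain ⟨h1, h2⟩ := this
    simp only [β] at h1 h2
    constructor <;> linarith
  · rw [SchwartzMap.fourierInv_coe, Real.fourierInv_eq']
    change ∫ v : ℝ, cexp ((2 * π * inner ℝ v 0 : ℝ) * I) • (β v : ℂ) ≠ 0
    simp only [inner_zero_right, mul_zero, ofReal_zero, zero_mul, Complex.exp_zero, one_smul]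
    rw [integral_complex_ofReal]
    exact_mod_cast β.integral_pos.ne'

/-- A function that decays quadratically is dominated at the points `x - j M`, `j ≠ k`, when
`x` is close to `k M`. -/
lemma exists_separation {Ψ : ℝ → ℂ} {A κ : ℝ} (hA : ∀ y, ‖y‖ ^ 2 * ‖Ψ y‖ ≤ A) (hκ : 0 < κ) :
    ∃ M : ℕ, 2 ≤ M ∧ ∀ (N k : ℕ) (x : ℝ), |x - k * M| ≤ 1 →
      ∑ j ∈ (Finset.range N).erase k, ‖Ψ (x - j * M)‖ ≤ κ := by
  have hA0 : 0 ≤ A := le_trans (by positivity) (hA 0)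
  have hsum : Summable (fun n : ℤ ↦ 1 / (n : ℝ) ^ 2) :=
    Real.summable_one_div_int_pow.mpr one_lt_two
  set B := ∑' n : ℤ, 1 / (n : ℝ) ^ 2
  have hB : 0 ≤ B := tsum_nonneg fun n ↦ by positivity
  obtain ⟨M, hM⟩ := exists_nat_ge (2 + 4 * A * B / κ)
  have hM2 : (2 : ℝ) ≤ M := le_trans (by linarith [show 0 ≤ 4 * A * B / κ by positivity]) hM
  refine ⟨M, by exact_mod_cast hM2, fun N k x hx ↦ ?_⟩
  have hterm : ∀ j ∈ (Finset.range N).erase k,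
      ‖Ψ (x - j * M)‖ ≤ 4 * A / M ^ 2 * (1 / (((j : ℤ) - k : ℤ) : ℝ) ^ 2) := by
    intro j hj
    have hjk : j ≠ k := (Finset.mem_erase.mp hj).1
    have hd : (1 : ℝ) ≤ |(((j : ℤ) - k : ℤ) : ℝ)| := by
      have : (1 : ℤ) ≤ |(j : ℤ) - k| := Int.one_le_abs (by omega)
      exact_mod_cast this
    set d : ℝ := |(((j : ℤ) - k : ℤ) : ℝ)| with hd_def
    have hsq : (((j : ℤ) - k : ℤ) : ℝ) ^ 2 = d ^ 2 := by
      rw [hd_def]; push_cast; rw [sq_abs]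
    have hdr : d = |(j : ℝ) - k| := by rw [hd_def]; push_cast; rfl
    have hlow : d * M / 2 ≤ |x - j * M| := by
      have h1 : d * M = |(j : ℝ) * M - k * M| := by
        rw [hdr, ← sub_mul, abs_mul, abs_of_nonneg (by positivity : (0 : ℝ) ≤ M)]
      have h2 : |(j : ℝ) * M - k * M| ≤ |x - k * M| + |x - j * M| := by
        have := abs_sub (x - k * M) (x - j * M)
        rwa [show x - k * M - (x - j * M) = (j : ℝ) * M - k * M by ring] at this
      nlinarith
    have hpos : 0 < d * M / 2 := by positivity
    have h3 : (d * M / 2) ^ 2 * ‖Ψ (x - j * M)‖ ≤ A := by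
      refine le_trans ?_ (hA (x - j * M))
      rw [Real.norm_eq_abs]
      gcongr
    rw [hsq]
    have : 4 * A / M ^ 2 * (1 / d ^ 2) = A / (d * M / 2) ^ 2 := by
      have : d ≠ 0 := by positivity
      have : (M : ℝ) ≠ 0 := by positivity
      field_simp
      ring
    rw [this, le_div_iff₀ (by positivity)]
    linarith
  have hinj : Function.Injective (fun j : ℕ ↦ (j : ℤ) - k) := fun i j hij ↦ by
    simp only at hij; omega
  calc _ ≤ ∑ j ∈ (Finset.range N).erase k,
        4 * A / M ^ 2 * (1 / (((j : ℤ) - k : ℤ) : ℝ) ^ 2) := Finset.sum_le_sum hterm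
    _ = 4 * A / M ^ 2 * ∑ n ∈ ((Finset.range N).erase k).image (fun j : ℕ ↦ (j : ℤ) - k),
        1 / (n : ℝ) ^ 2 := by
      rw [Finset.sum_image hinj.injOn, Finset.mul_sum]
    _ ≤ 4 * A / M ^ 2 * B := by
      gcongr
      exact hsum.sum_le_tsum _ fun n _ ↦ by positivity
    _ ≤ κ := by
      have h1 : 4 * A * B / κ ≤ M := by linarith
      rw [div_le_iff₀ hκ] at h1
      rw [div_mul_eq_mul_div, div_le_iff₀ (by positivity)]
      nlinarith [mul_pos hκ (by positivity : (0 : ℝ) < M)]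

lemma volume_biUnion_Icc_translates {M : ℕ} (hM : 2 ≤ M) {δ : ℝ} (hδ1 : δ ≤ 1)
    (N : ℕ) :
    volume (⋃ k ∈ Finset.range N, Set.Icc ((k : ℝ) * M) (k * M + δ)) = ENNReal.ofReal (N * δ) := by
  rw [measure_biUnion_finset _ fun _ _ ↦ measurableSet_Icc]
  · simp [Real.volume_Icc, ENNReal.ofReal_mul]
  · have hM' : (2 : ℝ) ≤ M := by exact_mod_cast hM
    have key : ∀ i j : ℕ, i < j →
        Disjoint (Set.Icc ((i : ℝ) * M) (i * M + δ)) (Set.Icc ((j : ℝ) * M) (j * M + δ)) := by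
      intro i j hij
      rw [Set.disjoint_left]
      rintro y ⟨_, h1⟩ ⟨h2, _⟩
      have : (i : ℝ) + 1 ≤ j := by exact_mod_cast hij
      nlinarith
    intro i _ j _ hij
    rcases lt_or_gt_of_ne hij with h | h
    · exact key i j h
    · exact (key j i h).symm

lemma eLpNorm_modulated_dilation (Ψ f : SchwartzMap ℝ ℂ) {a b q : ℝ} (ha : 0 < a) (hq : 0 < q)
    (hf : ∀ x, f x = cexp (2 * π * I * b * x) * Ψ (a * x - 0)) :
    eLpNorm ⇑f (ENNReal.ofReal q) volume =
      ENNReal.ofReal (a⁻¹ ^ (1 / q) * (eLpNorm ⇑Ψ (ENNReal.ofReal q) volume).toReal) := by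
  have h1 : eLpNorm ⇑f (ENNReal.ofReal q) volume =
      eLpNorm (⇑Ψ ∘ fun x ↦ a * x) (ENNReal.ofReal q) volume := by
    refine eLpNorm_congr_norm_ae (Filter.Eventually.of_forall fun x ↦ ?_)
    rw [hf, norm_mul, show 2 * π * I * b * x = ((2 * π * b * x : ℝ) : ℂ) * I by push_cast; ring,
      norm_exp_ofReal_mul_I, one_mul, sub_zero, Function.comp]
  rw [h1, ← eLpNorm_map_measure Ψ.continuous.aestronglyMeasurable (by fun_prop),
    Real.map_volume_mul_left ha.ne', eLpNorm_smul_measure_of_ne_top ENNReal.ofReal_ne_top,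
    ENNReal.ofReal_mul (by positivity),
    ENNReal.ofReal_toReal (Ψ.eLpNorm_lt_top (ENNReal.ofReal q) volume).ne,
    abs_of_pos (by positivity), smul_eq_mul, one_div, ENNReal.toReal_inv,
    ENNReal.toReal_ofReal hq.le, one_div, ENNReal.ofReal_rpow_of_pos (by positivity)]

lemma sum_norm_translates_le_indicator {φ : ℝ → ℂ} (hφ1 : ∀ ξ, ‖φ ξ‖ ≤ 1)
    (hφs : ∀ ξ, φ ξ ≠ 0 → 0 < ξ ∧ ξ < 1) (N : ℕ) (ξ : ℝ) :
    ∑ k ∈ Finset.range N, ‖φ (ξ - k)‖ ≤ Set.indicator (Set.Icc (0 : ℝ) N) (fun _ ↦ (1 : ℝ)) ξ := by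
  have hsub : ∀ k : ℕ, φ (ξ - k) ≠ 0 → (k : ℝ) < ξ ∧ ξ < k + 1 := fun k hk ↦ by
    have := hφs _ hk
    constructor <;> linarith
  by_cases h : ∃ k ∈ Finset.range N, φ (ξ - k) ≠ 0
  · obtain ⟨k, hk, hne⟩ := h
    obtain ⟨h1, h2⟩ := hsub k hne
    have hkN : (k : ℝ) + 1 ≤ N := by exact_mod_cast Finset.mem_range.mp hk
    rw [Set.indicator_of_mem (show ξ ∈ Set.Icc (0 : ℝ) N from
      ⟨le_trans (by positivity) h1.le, by linarith⟩), Finset.sum_eq_single_of_mem k hk]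
    · exact hφ1 _
    · intro j _ hjk
      by_contra hj
      obtain ⟨h3, h4⟩ := hsub j (by simpa using hj)
      have h5 : (k : ℝ) < j + 1 := by linarith
      have h6 : (j : ℝ) < k + 1 := by linarith
      norm_cast at h5 h6
      omega
  · push Not at h
    rw [Finset.sum_eq_zero fun k hk ↦ by rw [h k hk, norm_zero]]
    exact Set.indicator_nonneg (fun _ _ ↦ zero_le_one) _

lemma exists_nat_rpow_dominates {K₁ K₂ s t : ℝ} (hK₂ : 0 < K₂) (hst : s < t) :
    ∃ N : ℕ, 0 < N ∧ K₁ * (N : ℝ) ^ s < K₂ * (N : ℝ) ^ t := by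
  have h := ((tendsto_rpow_atTop (sub_pos.mpr hst)).comp
    tendsto_natCast_atTop_atTop).eventually_gt_atTop (K₁ / K₂)
  obtain ⟨N, hN, hN0⟩ := (h.and (Filter.eventually_gt_atTop 0)).exists
  refine ⟨N, hN0, ?_⟩
  have hN0' : (0 : ℝ) < N := by exact_mod_cast hN0
  simp only [Function.comp] at hN
  rw [Real.rpow_sub hN0', div_lt_div_iff₀ hK₂ (by positivity)] at hN
  linarith

/-- A sum of `N` wave packets at separated positions and adjacent frequencies. -/
lemma exists_packet_train (φ : SchwartzMap ℝ ℂ) (hφ : HasCompactSupport φ) (hφ1 : ∀ ξ, ‖φ ξ‖ ≤ 1)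
    (hφs : ∀ ξ, φ ξ ≠ 0 → 0 < ξ ∧ ξ < 1) (N M : ℕ) :
    ∃ h : SchwartzMap ℝ ℂ,
      (∀ x, h x = ∑ k ∈ Finset.range N, cexp (2 * π * I * (k : ℝ) * x) * 𝓕⁻ φ (x - k * M)) ∧
      (∀ ξ, ‖𝓕 ⇑h ξ‖ ≤ Set.indicator (Set.Icc (0 : ℝ) N) (fun _ ↦ (1 : ℝ)) ξ) := by
  choose W hW hWf using fun k : ℕ ↦ exists_wavePacket φ hφ one_pos (k : ℝ) (k * M)
  refine ⟨∑ k ∈ Finset.range N, W k, fun x ↦ ?_, fun ξ ↦ ?_⟩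
  · rw [sum_apply]
    exact Finset.sum_congr rfl fun k _ ↦ by rw [hW, one_mul]
  · rw [← SchwartzMap.fourier_coe, FourierTransform.fourier_sum, sum_apply]
    refine le_trans (norm_sum_le _ _) (le_trans (Finset.sum_le_sum fun k _ ↦ ?_)
      (sum_norm_translates_le_indicator hφ1 hφs N ξ))
    rw [SchwartzMap.fourier_coe, hWf, norm_mul, norm_mul,
      show -(2 * π * I * ((k * M : ℝ) : ℂ) * ((ξ - k) / 1 : ℝ)) =
        ((-(2 * π * (k * M) * (ξ - k)) : ℝ) : ℂ) * I by push_cast; ring,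
      norm_exp_ofReal_mul_I]
    simp

lemma packet_train_lower_bound {Ψ h : ℝ → ℂ} {κ δ : ℝ} {M N : ℕ}
    (hΨ : ∀ y, |y| ≤ δ → 2 * κ ≤ ‖Ψ y‖) (hδ1 : δ ≤ 1)
    (hM : ∀ (N k : ℕ) (x : ℝ), |x - k * M| ≤ 1 →
      ∑ j ∈ (Finset.range N).erase k, ‖Ψ (x - j * M)‖ ≤ κ)
    (hh : ∀ x, h x = ∑ k ∈ Finset.range N, cexp (2 * π * I * (k : ℝ) * x) * Ψ (x - k * M))
    {k : ℕ} (hk : k ∈ Finset.range N) {x : ℝ} (hx : |x - k * M| ≤ δ) : κ ≤ ‖h x‖ := by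
  have hnorm : ∀ j : ℕ, ‖cexp (2 * π * I * (j : ℝ) * x) * Ψ (x - j * M)‖ = ‖Ψ (x - j * M)‖ := by
    intro j
    rw [norm_mul, show 2 * π * I * (j : ℝ) * x = ((2 * π * j * x : ℝ) : ℂ) * I by push_cast; ring,
      norm_exp_ofReal_mul_I, one_mul]
  have h1 : ‖∑ j ∈ (Finset.range N).erase k, cexp (2 * π * I * (j : ℝ) * x) * Ψ (x - j * M)‖ ≤ κ :=
    (norm_sum_le _ _).trans (by simpa only [hnorm] using hM N k x (hx.trans hδ1))
  rw [hh, ← Finset.add_sum_erase _ _ hk]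
  have h2 := norm_sub_le_norm_add (cexp (2 * π * I * (k : ℝ) * x) * Ψ (x - k * M))
    (∑ j ∈ (Finset.range N).erase k, cexp (2 * π * I * (j : ℝ) * x) * Ψ (x - j * M))
  rw [hnorm] at h2
  linarith [hΨ _ hx]

/-- the Biest `C₃^{(1,1,1)}` satisfies no estimate of the form
`L^{p₁} × L^{p₂} × W_{p₃} → L^{1/(1/p₁+1/p₂+1/p₃)}` when `p₃ < 2`. -/
theorem stmt10 (p₁ p₂ p₃ : ℝ) (hp₁ : 1 < p₁) (hp₂ : 1 < p₂) (hp₃ : 1 < p₃)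
    (hp₃' : p₃ < 2) (C : ℝ) (hC : 0 < C) :
    ∃ f g h : SchwartzMap ℝ ℂ,
      HasCompactSupport (𝓕 ⇑f) ∧ HasCompactSupport (𝓕 ⇑g) ∧ HasCompactSupport (𝓕 ⇑h) ∧
      ENNReal.ofReal C *
          eLpNorm ⇑f (ENNReal.ofReal p₁) volume *
          eLpNorm ⇑g (ENNReal.ofReal p₂) volume *
          eLpNorm (𝓕 ⇑h) (ENNReal.ofReal (p₃ / (p₃ - 1))) volume <
        eLpNorm (Cop ![(1 : ℝ), 1, 1] ![⇑f, ⇑g, ⇑h])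
          (ENNReal.ofReal (1 / (1 / p₁ + 1 / p₂ + 1 / p₃))) volume := by
  obtain ⟨φ, hφ, hφ1, hφs, hφ0⟩ := exists_bump_profile
  set Ψ : SchwartzMap ℝ ℂ := 𝓕⁻ φ with hΨdef
  obtain ⟨κ, hκ, δ, hδ, hδ1, hΨδ⟩ : ∃ κ > 0, ∃ δ > 0, δ ≤ 1 ∧ ∀ y, |y| ≤ δ → 2 * κ ≤ ‖Ψ y‖ := by
    have hpos : 0 < ‖Ψ 0‖ := norm_pos_iff.mpr hφ0
    have hev : ∀ᶠ y in nhds (0 : ℝ), ‖Ψ 0‖ / 2 < ‖Ψ y‖ :=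
      Ψ.continuous.norm.continuousAt.eventually_const_lt (by linarith)
    obtain ⟨η, hη, hηΨ⟩ := Metric.eventually_nhds_iff.mp hev
    refine ⟨‖Ψ 0‖ / 4, by positivity, min (η / 2) 1, by positivity, min_le_right _ _,
      fun y hy ↦ ?_⟩
    have := hηΨ (y := y) (by
      rw [dist_zero_right, Real.norm_eq_abs]; linarith [min_le_left (η / 2) 1])
    linarith
  obtain ⟨A, -, hA⟩ := Ψ.decay 2 0
  simp only [norm_iteratedFDeriv_zero] at hA
  obtain ⟨M, hM2, hM⟩ := exists_separation hA hκ
  have hM0 : (0 : ℝ) < M := by exact_mod_cast (by omega : 0 < M)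
  set e₁ := (eLpNorm ⇑Ψ (ENNReal.ofReal p₁) volume).toReal with he₁
  set e₂ := (eLpNorm ⇑Ψ (ENNReal.ofReal p₂) volume).toReal with he₂
  have hp₁0 : 0 < p₁ := by linarith
  have hp₂0 : 0 < p₂ := by linarith
  have hp₃0 : 0 < p₃ := by linarith
  set σ := 1 / p₁ + 1 / p₂ + 1 / p₃ with hσ
  have hσ0 : 0 < σ := by positivity
  obtain ⟨N, hN, hlt⟩ := exists_nat_rpow_dominates
    (K₁ := C * ((M / δ) ^ (1 / p₁) * e₁) * ((M / δ) ^ (1 / p₂) * e₂)) (K₂ := κ ^ 3 * δ ^ σ)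
    (s := 1 / p₁ + 1 / p₂ + (1 - 1 / p₃)) (t := σ) (by positivity) (by
      have : 1 / 2 < 1 / p₃ := one_div_lt_one_div_of_lt hp₃0 hp₃'
      rw [hσ]; linarith)
  have hN0 : (0 : ℝ) < N := by exact_mod_cast hN
  have hN1 : (1 : ℝ) ≤ N := by exact_mod_cast hN
  have hM2' : (2 : ℝ) ≤ M := by exact_mod_cast hM2
  set a := δ / (N * M) with ha_def
  have ha : 0 < a := by positivity
  have ha1 : a ≤ 1 := by
    rw [ha_def, div_le_one (by positivity)]; nlinarith
  obtain ⟨f, hf, hfF⟩ := exists_wavePacket φ hφ ha (-4) 0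
  obtain ⟨g, hg, hgF⟩ := exists_wavePacket φ hφ ha (-2) 0
  obtain ⟨h, hh, hhF⟩ := exists_packet_train φ hφ hφ1 hφs N M
  rw [← hΨdef] at hf hg hh
  have hsupp : ∀ b ξ, φ ((ξ - b) / a) ≠ 0 → b < ξ ∧ ξ < b + 1 := by
    intro b ξ hne
    obtain ⟨h1, h2⟩ := hφs _ hne
    have h1 : 0 < ξ - b := by simpa [ha] using (lt_div_iff₀ ha).mp h1
    rw [div_lt_one ha] at h2
    constructor <;> linarith
  have hfs : ∀ ξ, 𝓕 ⇑f ξ ≠ 0 → -4 < ξ ∧ ξ < -4 + 1 := fun ξ hne ↦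
    hsupp _ _ (right_ne_zero_of_mul (hfF ξ ▸ hne))
  have hgs : ∀ ξ, 𝓕 ⇑g ξ ≠ 0 → -2 < ξ ∧ ξ < -2 + 1 := fun ξ hne ↦
    hsupp _ _ (right_ne_zero_of_mul (hgF ξ ▸ hne))
  have hhs : ∀ ξ, 𝓕 ⇑h ξ ≠ 0 → ξ ∈ Set.Icc (0 : ℝ) N := by
    intro ξ hne
    by_contra hξ
    have := hhF ξ
    rw [Set.indicator_of_notMem hξ] at this
    exact hne (norm_le_zero_iff.mp this)
  refine ⟨f, g, h, .of_support_subset_isCompact (isCompact_Icc (a := -4) (b := -4 + 1))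
      fun ξ hξ ↦ ⟨(hfs ξ hξ).1.le, (hfs ξ hξ).2.le⟩,
    .of_support_subset_isCompact (isCompact_Icc (a := -2) (b := -2 + 1))
      fun ξ hξ ↦ ⟨(hgs ξ hξ).1.le, (hgs ξ hξ).2.le⟩,
    .of_support_subset_isCompact (isCompact_Icc (a := 0) (b := (N : ℝ))) hhs, ?_⟩
  have hprod : Cop ![(1 : ℝ), 1, 1] ![⇑f, ⇑g, ⇑h] = fun x ↦ f x * g x * h x :=
    funext <| Cop_eq_mul_of_support f g h (a := -5 / 2) (b := -1 / 2)
      (fun ξ hξ ↦ by linarith [hfs ξ hξ])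
      (fun ξ hξ ↦ ⟨by linarith [hgs ξ hξ], by linarith [hgs ξ hξ]⟩)
      (fun ξ hξ ↦ by linarith [(hhs ξ hξ).1])
  set S : Set ℝ := ⋃ k ∈ Finset.range N, Set.Icc ((k : ℝ) * M) (k * M + δ) with hS
  have hSm : MeasurableSet S := Finset.measurableSet_biUnion _ fun _ _ ↦ measurableSet_Icc
  have hlow : ∀ x ∈ S, κ ^ 3 ≤ ‖f x * g x * h x‖ := by
    intro x hx
    simp only [hS, Set.mem_iUnion] at hx
    obtain ⟨k, hk, hx1, hx2⟩ := hx
    have hkN : (k : ℝ) + 1 ≤ N := by exact_mod_cast Finset.mem_range.mp hk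
    have hax : |a * x - 0| ≤ δ := by
      have hx0 : 0 ≤ x := le_trans (by positivity) hx1
      have hxN : x ≤ N * M := by nlinarith
      rw [sub_zero, abs_of_nonneg (by positivity), ha_def, div_mul_eq_mul_div,
        div_le_iff₀ (by positivity)]
      gcongr
    have hΨx := hΨδ _ hax
    have hmod : ∀ b : ℝ, κ ≤ ‖cexp (2 * π * I * b * x) * Ψ (a * x - 0)‖ := by
      intro b
      rw [norm_mul, show 2 * π * I * b * x = ((2 * π * b * x : ℝ) : ℂ) * I by push_cast; ring,
        norm_exp_ofReal_mul_I]
      linarith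
    have h1 : κ ≤ ‖f x‖ := by rw [hf]; exact hmod _
    have h2 : κ ≤ ‖g x‖ := by rw [hg]; exact hmod _
    have h3 : κ ≤ ‖h x‖ := packet_train_lower_bound hΨδ hδ1 hM hh hk (by
      rw [abs_of_nonneg] <;> linarith)
    rw [norm_mul, norm_mul, show κ ^ 3 = κ * κ * κ by ring]
    gcongr
  have hupper : eLpNorm (𝓕 ⇑h) (ENNReal.ofReal (p₃ / (p₃ - 1))) volume ≤
      ENNReal.ofReal ((N : ℝ) ^ (1 - 1 / p₃)) := by
    have hp : 0 < p₃ / (p₃ - 1) := div_pos hp₃0 (by linarith)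
    refine (eLpNorm_mono_real hhF).trans ((eLpNorm_indicator_const_le _ _).trans_eq ?_)
    rw [Real.volume_Icc, ENNReal.toReal_ofReal hp.le, sub_zero,
      ENNReal.ofReal_rpow_of_pos hN0, enorm_one, one_mul]
    congr 2
    field_simp
  have hlower : ENNReal.ofReal (κ ^ 3 * (N * δ) ^ σ) ≤
      eLpNorm (fun x ↦ f x * g x * h x) (ENNReal.ofReal (1 / σ)) volume := by
    calc _ = eLpNorm (S.indicator fun _ ↦ κ ^ 3) (ENNReal.ofReal (1 / σ)) volume := by
          rw [eLpNorm_indicator_const hSm (by simpa using hσ0) ENNReal.ofReal_ne_top,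
            volume_biUnion_Icc_translates hM2 hδ1, ENNReal.toReal_ofReal (by positivity),
            one_div_one_div, ENNReal.ofReal_rpow_of_pos (by positivity),
            ENNReal.ofReal_mul (by positivity), Real.enorm_of_nonneg (by positivity)]
      _ ≤ _ := by
          refine eLpNorm_mono fun x ↦ ?_
          by_cases hx : x ∈ S
          · rw [Set.indicator_of_mem hx, Real.norm_of_nonneg (by positivity)]
            exact hlow x hx
          · rw [Set.indicator_of_notMem hx, norm_zero]
            positivity
  rw [hprod, eLpNorm_modulated_dilation Ψ f ha hp₁0 hf, eLpNorm_modulated_dilation Ψ g ha hp₂0 hg,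
    ← he₁, ← he₂]
  refine lt_of_le_of_lt (mul_le_mul_right hupper _) (lt_of_lt_of_le ?_ hlower)
  rw [← ENNReal.ofReal_mul hC.le, ← ENNReal.ofReal_mul (by positivity),
    ← ENNReal.ofReal_mul (by positivity), ENNReal.ofReal_lt_ofReal_iff (by positivity)]
  have hainv : a⁻¹ = M / δ * N := by rw [ha_def]; field_simp
  rw [hainv, Real.mul_rpow (by positivity) hN0.le, Real.mul_rpow (by positivity) hN0.le,
    Real.mul_rpow hN0.le hδ.le]
  rw [Real.rpow_add hN0, Real.rpow_add hN0] at hlt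
  linarith
end

section
/- Let n ≥ 2 and p_1,…,p_n ∈ (1,∞), and suppose p_i < 2 for some index i. Then C_n^{(1,…,1)} is not bounded from W_{p_1} × ⋯ × W_{p_n} into L^{1/(Σ_{j=1}^n 1/p_j)}: for every constant C > 0 there exist Schwartz functions f_1,…,f_n with compactly supported Fourier transforms such that ‖C_n^{(1,…,1)}(f_1,…,f_n)‖_{L^{1/(Σ 1/p_j)}(ℝ)} > C ∏_{j=1}^n ‖f̂_j‖_{L^{p_j′}}. -/
open MeasureTheory Complex
open scoped FourierTransform Real ENNReal

open scoped SchwartzMap ContDiff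

/-- Existence of Rudin–Shapiro pairs of polynomials. -/
lemma exists_rudinShapiro_pair (m : ℕ) :
    ∃ a b : ℕ → ℂ, (∀ k, ‖a k‖ ≤ 1) ∧ (∀ k, ‖b k‖ ≤ 1) ∧ ∀ z : ℂ, ‖z‖ = 1 →
      ‖∑ k ∈ Finset.range (2 ^ m), a k * z ^ k‖ ^ 2 +
        ‖∑ k ∈ Finset.range (2 ^ m), b k * z ^ k‖ ^ 2 = 2 * 2 ^ m := by
  induction m with
  | zero => exact ⟨fun _ => 1, fun _ => 1, by simp, by simp, fun z _ => by norm_num⟩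
  | succ m ih =>
    obtain ⟨a, b, ha, hb, hab⟩ := ih
    refine ⟨fun k => if k < 2 ^ m then a k else b (k - 2 ^ m),
      fun k => if k < 2 ^ m then a k else -b (k - 2 ^ m), ?_, ?_, ?_⟩
    · intro k
      dsimp only
      split_ifs
      exacts [ha k, hb _]
    · intro k
      dsimp only
      split_ifs
      exacts [ha k, by simpa using hb _]
    · intro z hz
      have hsplit (c : ℕ → ℂ) :
          ∑ k ∈ Finset.range (2 ^ (m + 1)),
              (if k < 2 ^ m then a k else c (k - 2 ^ m)) * z ^ k =
            ∑ k ∈ Finset.range (2 ^ m), a k * z ^ k +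
              z ^ 2 ^ m * ∑ k ∈ Finset.range (2 ^ m), c k * z ^ k := by
        rw [pow_succ, mul_two, Finset.sum_range_add, Finset.mul_sum]
        congr 1
        · refine Finset.sum_congr rfl fun k hk => ?_
          rw [if_pos (Finset.mem_range.mp hk)]
        · refine Finset.sum_congr rfl fun k _ => ?_
          rw [if_neg (by omega), Nat.add_sub_cancel_left, pow_add]
          ring
      have hneg := hsplit (fun k => -b k)
      simp only [neg_mul, Finset.sum_neg_distrib, mul_neg] at hneg
      simp only [hsplit b, hneg, ← sub_eq_add_neg]
      rw [parallelogram_law_with_norm ℂ, norm_mul, norm_pow, hz, one_pow, one_mul, hab z hz]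
      ring

/-- There are trigonometric polynomials with `2 ^ m` unimodularly bounded coefficients which are
at least `√(2 ^ m)` in absolute value on half of the interval `[0, δ]`. -/
lemma exists_trigPoly_large (m : ℕ) (δ : ℝ) :
    ∃ a : ℕ → ℂ, (∀ k, ‖a k‖ ≤ 1) ∧
      ENNReal.ofReal (δ / 2) ≤ volume {x : ℝ | x ∈ Set.Icc 0 δ ∧
        √(2 ^ m) ≤ ‖∑ k ∈ Finset.range (2 ^ m), a k * exp (2 * π * I * x) ^ k‖} := by
  obtain ⟨a, b, ha, hb, hab⟩ := exists_rudinShapiro_pair m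
  by_contra! hcon
  have hA := hcon a ha
  have hB := hcon b hb
  refine absurd (measure_mono (μ := volume) (s := Set.Icc 0 δ) fun x hx => ?_)
    (not_le.mpr ((measure_union_le _ _).trans_lt (ENNReal.add_lt_add hA hB) |>.trans_le ?_))
  · have hz : ‖exp (2 * π * I * x)‖ = 1 := by
      rw [show 2 * π * I * x = ((2 * π * x : ℝ) : ℂ) * I by push_cast; ring, norm_exp_ofReal_mul_I]
    have h := hab _ hz
    by_contra hx'
    simp only [Set.mem_union, Set.mem_ofPred_eq, hx, true_and, not_or, not_le] at hx'
    have h1 := (Real.lt_sqrt (norm_nonneg _)).mp hx'.1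
    have h2 := (Real.lt_sqrt (norm_nonneg _)).mp hx'.2
    linarith
  · have hδ : 0 ≤ δ / 2 := by
      by_contra! h
      rw [ENNReal.ofReal_of_nonpos h.le] at hA
      exact not_lt_bot hA
    rw [Real.volume_Icc, ← ENNReal.ofReal_add hδ hδ]
    simp

/-- If the Fourier supports are ordered, the simplex restriction is void and `Cop` is the pointwise
product. -/
lemma Cop_one_eq_prod {n : ℕ} (f : Fin n → 𝓢(ℝ, ℂ)) (l u : Fin n → ℝ)
    (hsupp : ∀ i ξ, ξ ∉ Set.Icc (l i) (u i) → 𝓕 ⇑(f i) ξ = 0)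
    (hlu : ∀ i j, i < j → u i < l j) (x : ℝ) :
    Cop (fun _ : Fin n => (1 : ℝ)) (fun i => ⇑(f i)) x = ∏ i, f i x := by
  have hexp (t : Fin n → ℝ) :
      (∏ i, 𝓕 ⇑(f i) (t i)) * exp (2 * π * I * x * (∑ i, (1 : ℝ) * t i : ℝ)) =
        ∏ i, exp (↑(2 * π * inner ℝ (t i) x) * I) • 𝓕 ⇑(f i) (t i) := by
    simp only [smul_eq_mul, Finset.prod_mul_distrib, ← Complex.exp_sum]
    rw [mul_comm]
    congr 2
    push_cast
    rw [Finset.mul_sum]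
    refine Finset.sum_congr rfl fun i _ => ?_
    simp
    ring
  unfold Cop
  rw [setIntegral_eq_integral_of_forall_compl_eq_zero]
  · refine (integral_congr_ae (.of_forall hexp)).trans ?_
    rw [integral_fintype_prod_volume_eq_prod
      (fun i t => exp (↑(2 * π * inner ℝ t x) * I) • 𝓕 ⇑(f i) t)]
    refine Finset.prod_congr rfl fun i _ => ?_
    rw [← Real.fourierInv_eq', (f i).continuous.fourierInv_fourier_eq (f i).integrable
      (by simpa [SchwartzMap.fourier_coe] using (𝓕 (f i)).integrable)]
  · intro t ht
    have : ∃ i, t i ∉ Set.Icc (l i) (u i) := by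
      by_contra! h
      exact ht fun i j hij => ((h i).2.trans_lt (hlu i j hij)).trans_le (h j).1
    obtain ⟨i, hi⟩ := this
    rw [Finset.prod_eq_zero (Finset.mem_univ i) (hsupp i _ hi), zero_mul]

lemma fourierInv_comp_sub_right (φ : ℝ → ℂ) (s x : ℝ) :
    𝓕⁻ (fun ξ => φ (ξ - s)) x = exp (2 * π * I * s * x) * 𝓕⁻ φ x := by
  rw [Real.fourierInv_eq', Real.fourierInv_eq',
    ← integral_add_right_eq_self _ s, ← integral_const_mul]
  refine integral_congr_ae (.of_forall fun ξ => ?_)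
  simp only [add_sub_cancel_right, smul_eq_mul, ← mul_assoc, ← Complex.exp_add]
  congr 2
  simp
  ring

/-- Superposition of unit-spaced frequency translates of a bump supported in `[-1/4, 1/4]`. -/
lemma exists_schwartz_sum_translates (φ : ℝ → ℂ) (hφ : ContDiff ℝ ∞ φ) (h1 : ∀ x, ‖φ x‖ ≤ 1)
    (h0 : ∀ x, 1 / 4 ≤ |x| → φ x = 0) (N : ℕ) (a : ℕ → ℂ) (ha : ∀ k, ‖a k‖ ≤ 1) (s : ℝ) :
    ∃ f : 𝓢(ℝ, ℂ), (∀ ξ, ‖𝓕 ⇑f ξ‖ ≤ 1) ∧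
      (∀ ξ, ξ ∉ Set.Icc (s - 1 / 4) (s + N) → 𝓕 ⇑f ξ = 0) ∧
      ∀ x : ℝ, f x = exp (2 * π * I * s * x) *
        (∑ k ∈ Finset.range N, a k * exp (2 * π * I * x) ^ k) * 𝓕⁻ φ x := by
  set F : ℝ → ℂ := fun ξ => ∑ k ∈ Finset.range N, a k * φ (ξ - (s + k)) with hF
  have hFs : ∀ ξ, ξ ∉ Set.Icc (s - 1 / 4) (s + N) → F ξ = 0 := by
    intro ξ hξ
    refine Finset.sum_eq_zero fun k hk => ?_
    rw [h0, mul_zero]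
    have hk' : (k : ℝ) + 1 ≤ N := mod_cast Finset.mem_range.mp hk
    have hk0 : (0 : ℝ) ≤ k := k.cast_nonneg
    by_contra! h
    rw [abs_lt] at h
    exact hξ ⟨by linarith [h.1], by linarith [h.2]⟩
  have hFc : HasCompactSupport F := HasCompactSupport.intro isCompact_Icc hFs
  have hFd : ContDiff ℝ ∞ F := by
    refine ContDiff.sum fun k _ => contDiff_const.mul (hφ.comp (by fun_prop))
  have hF1 : ∀ ξ, ‖F ξ‖ ≤ 1 := by
    intro ξ
    by_cases h : ∀ k ∈ Finset.range N, φ (ξ - (s + k)) = 0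
    · have hz : F ξ = 0 := Finset.sum_eq_zero fun k hk => by rw [h k hk, mul_zero]
      rw [hz]
      simp
    · push Not at h
      obtain ⟨k, hk, hne⟩ := h
      have hlt : |ξ - (s + k)| < 1 / 4 := not_le.mp fun h => hne (h0 _ h)
      have hsum : F ξ = a k * φ (ξ - (s + k)) := by
        refine Finset.sum_eq_single_of_mem k hk fun j _ hj => ?_
        rw [h0, mul_zero]
        by_contra! h
        rw [abs_lt] at h hlt
        refine hj (le_antisymm (Nat.lt_succ_iff.mp ?_) (Nat.lt_succ_iff.mp ?_))
        · have : (j : ℝ) < k + 1 := by linarith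
          exact_mod_cast this
        · have : (k : ℝ) < j + 1 := by linarith
          exact_mod_cast this
      rw [hsum, norm_mul]
      exact mul_le_one₀ (ha k) (norm_nonneg _) (h1 _)
  set G : 𝓢(ℝ, ℂ) := hFc.toSchwartzMap hFd
  have hG : 𝓕 ⇑(𝓕⁻ G : 𝓢(ℝ, ℂ)) = F := by
    rw [← SchwartzMap.fourier_coe, FourierTransform.fourier_fourierInv_eq]
    rfl
  refine ⟨𝓕⁻ G, fun ξ => hG ▸ hF1 ξ, fun ξ hξ => hG ▸ hFs ξ hξ, fun x => ?_⟩
  rw [SchwartzMap.fourierInv_coe]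
  change 𝓕⁻ F x = _
  have hterm (k : ℕ) : ∫ ξ, exp (↑(2 * π * inner ℝ ξ x) * I) • (a k * φ (ξ - (s + k))) =
      a k * (exp (2 * π * I * (s + k : ℝ) * x) * 𝓕⁻ φ x) := by
    rw [← fourierInv_comp_sub_right, Real.fourierInv_eq', ← integral_const_mul]
    exact integral_congr_ae (.of_forall fun ξ => by simp only [smul_eq_mul]; ring)
  rw [Real.fourierInv_eq']
  simp only [hF, Finset.smul_sum]
  rw [integral_finsetSum]
  · simp only [hterm, Finset.mul_sum, Finset.sum_mul]
    refine Finset.sum_congr rfl fun k _ => ?_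
    rw [← Complex.exp_nat_mul]
    have : exp (2 * π * I * (s + k : ℝ) * x) =
        exp (2 * π * I * s * x) * exp (k * (2 * π * I * x)) := by
      rw [← Complex.exp_add]
      push_cast
      ring_nf
    rw [this]
    ring
  · intro k _
    refine Continuous.integrable_of_hasCompactSupport ?_ ?_
    · have := hφ.continuous
      fun_prop
    · refine HasCompactSupport.intro (K := Set.Icc (s + k - 1 / 4) (s + k + 1 / 4))
        isCompact_Icc fun ξ hξ => ?_
      rw [h0, mul_zero, smul_zero]
      by_contra! h
      rw [abs_lt] at h
      exact hξ ⟨by linarith [h.1], by linarith [h.2]⟩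

/-- A smooth bump supported in `[-1/4, 1/4]` whose inverse Fourier transform is bounded below
near the origin. -/
lemma exists_bump_fourierInv_lower :
    ∃ φ : ℝ → ℂ, ContDiff ℝ ∞ φ ∧ (∀ x, ‖φ x‖ ≤ 1) ∧ (∀ x, 1 / 4 ≤ |x| → φ x = 0) ∧
      ∃ c > 0, ∃ δ > 0, ∀ x ∈ Set.Icc (0 : ℝ) δ, c ≤ ‖𝓕⁻ φ x‖ := by
  let b : ContDiffBump (0 : ℝ) := ⟨1 / 8, 1 / 4, by norm_num, by norm_num⟩
  set φ : ℝ → ℂ := fun x => (b x : ℂ) with hφ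
  have hsm : ContDiff ℝ ∞ φ := Complex.ofRealCLM.contDiff.comp b.contDiff
  have hcs : HasCompactSupport φ := b.hasCompactSupport.comp_left Complex.ofReal_zero
  refine ⟨φ, hsm, fun x => ?_, fun x hx => ?_, ?_⟩
  · simp only [hφ, Complex.norm_real, Real.norm_of_nonneg b.nonneg]
    exact b.le_one
  · have : b x = 0 := b.zero_of_le_dist (by rwa [Real.dist_eq, sub_zero])
    simp only [hφ, this, Complex.ofReal_zero]
  · have hcont : Continuous (𝓕⁻ φ) := by
      have := (𝓕⁻ (hcs.toSchwartzMap hsm)).continuous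
      rwa [SchwartzMap.fourierInv_coe] at this
    have h0 : 𝓕⁻ φ 0 = ((∫ x, b x : ℝ) : ℂ) := by
      rw [Real.fourierInv_eq', ← integral_complex_ofReal]
      simp [hφ]
    have hpos : 0 < ‖𝓕⁻ φ 0‖ := by
      rw [h0, Complex.norm_real]
      exact norm_pos_iff.mpr b.integral_pos.ne'
    have hev := hcont.norm.continuousAt.eventually (lt_mem_nhds (half_lt_self hpos))
    obtain ⟨ε, hε, hball⟩ := Metric.eventually_nhds_iff.mp hev
    refine ⟨_, half_pos hpos, ε / 2, half_pos hε, fun x hx => (hball ?_).le⟩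
    rw [Real.dist_eq, sub_zero, abs_of_nonneg hx.1]
    linarith [hx.2]

/-- `L^q` bound for a function bounded by one and supported in an interval. -/
lemma eLpNorm_le_of_norm_le_one {g : ℝ → ℂ} {l u q : ℝ} (hq : 0 < q) (hlu : l ≤ u)
    (h1 : ∀ x, ‖g x‖ ≤ 1) (h0 : ∀ x, x ∉ Set.Icc l u → g x = 0) :
    eLpNorm g (ENNReal.ofReal q) volume ≤ ENNReal.ofReal ((u - l) ^ (1 / q)) := by
  rw [← eLpNorm_restrict_eq_of_support_subset (s := Set.Icc l u)
    fun x hx => by_contra fun h => hx (h0 x h)]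
  refine (eLpNorm_le_of_ae_bound (C := 1) (.of_forall h1)).trans_eq ?_
  rw [ENNReal.ofReal_one, mul_one, Measure.restrict_apply_univ, Real.volume_Icc,
    ENNReal.toReal_ofReal hq.le, ENNReal.ofReal_rpow_of_nonneg (by linarith) (by positivity),
    one_div]

/-- Chebyshev's inequality as a lower bound for the `L^r` norm. -/
lemma le_eLpNorm_of_le_norm {g : ℝ → ℂ} (hg : AEStronglyMeasurable g volume) {r A D : ℝ}
    (hr : 0 < r) (hA : 0 ≤ A) (hD : 0 ≤ D)
    (h : ENNReal.ofReal D ≤ volume {x | A ≤ ‖g x‖}) :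
    ENNReal.ofReal (A * D ^ (1 / r)) ≤ eLpNorm g (ENNReal.ofReal r) volume := by
  have hch := mul_meas_ge_le_pow_eLpNorm' (μ := volume) (p := ENNReal.ofReal r)
    (by simpa using hr) ENNReal.ofReal_ne_top hg (ENNReal.ofReal A)
  rw [ENNReal.toReal_ofReal hr.le] at hch
  have hset : {x | ENNReal.ofReal A ≤ ‖g x‖ₑ} = {x | A ≤ ‖g x‖} := by
    ext x
    simp only [Set.mem_ofPred_eq]
    rw [← ofReal_norm, ENNReal.ofReal_le_ofReal_iff (norm_nonneg _)]
  rw [hset] at hch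
  rw [← ENNReal.rpow_le_rpow_iff hr]
  refine le_trans ?_ hch
  rw [ENNReal.ofReal_rpow_of_nonneg (by positivity) hr.le, Real.mul_rpow hA (by positivity),
    ← Real.rpow_mul hD, one_div_mul_cancel hr.ne', Real.rpow_one,
    ENNReal.ofReal_mul (by positivity), ENNReal.ofReal_rpow_of_nonneg hA hr.le]
  gcongr

/-- `C_n^{(1,…,1)}` is not bounded from `W_{p₁} × ⋯ × W_{p_n}` into
`L^{1/(Σ 1/p_j)}` if some `p_i < 2`. -/
theorem stmt11 (n : ℕ) (hn : 2 ≤ n) (p : Fin n → ℝ) (hp : ∀ i, 1 < p i)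
    (hsmall : ∃ i, p i < 2) (C : ℝ) (hC : 0 < C) :
    ∃ f : Fin n → SchwartzMap ℝ ℂ,
      (∀ i, HasCompactSupport (𝓕 ⇑(f i))) ∧
      ENNReal.ofReal C *
          ∏ j, eLpNorm (𝓕 ⇑(f j)) (ENNReal.ofReal (p j / (p j - 1))) volume <
        eLpNorm (Cop (fun _ : Fin n => (1 : ℝ)) (fun i => ⇑(f i)))
          (ENNReal.ofReal (1 / ∑ j, 1 / p j)) volume := by
  obtain ⟨i₀, hi₀⟩ := hsmall
  obtain ⟨φ, hφ, h1, h0, c, hc, δ, hδ, hlow⟩ := exists_bump_fourierInv_lower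
  set r : ℝ := 1 / ∑ j, 1 / p j
  have hr : 0 < r := one_div_pos.mpr <| Finset.sum_pos
    (fun j _ => one_div_pos.mpr (one_pos.trans (hp j))) ⟨i₀, Finset.mem_univ _⟩
  set q : Fin n → ℝ := fun j => p j / (p j - 1) with hq_def
  have hq1 (j : Fin n) : 1 < q j := by
    rw [hq_def, one_lt_div (by linarith [hp j])]
    linarith
  have hq0 (j : Fin n) : 0 < q j := one_pos.trans (hq1 j)
  have hq2 : 2 < q i₀ := by
    rw [hq_def, lt_div_iff₀ (by linarith [hp i₀])]
    linarith
  set θ : ℝ := 1 / 2 - 1 / q i₀ with hθ_def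
  have hθ : 0 < θ := sub_pos.mpr (one_div_lt_one_div_of_lt two_pos hq2)
  set D : ℝ := (δ / 2) ^ (1 / r)
  have hD : 0 < D := by positivity
  obtain ⟨m, hm⟩ : ∃ m : ℕ, C * 2 ^ n / (c ^ n * D) < ((2 : ℝ) ^ m) ^ θ :=
    (((tendsto_rpow_atTop hθ).comp
      (tendsto_pow_atTop_atTop_of_one_lt one_lt_two)).eventually_gt_atTop _).exists
  obtain ⟨a, ha, hE⟩ := exists_trigPoly_large m δ
  set M : ℕ := 2 ^ m with hM
  have hM1 : (1 : ℝ) ≤ M := by exact_mod_cast Nat.one_le_two_pow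
  set N : Fin n → ℕ := fun j => if j = i₀ then M else 1 with hN
  have hN1 (j : Fin n) : (1 : ℝ) ≤ N j := by
    simp only [hN]
    split_ifs
    exacts [hM1, by simp]
  have hNM (j : Fin n) : (N j : ℝ) ≤ M := by
    simp only [hN]
    split_ifs
    exacts [le_rfl, by simpa using hM1]
  set s : Fin n → ℝ := fun j => (j : ℕ) * (M + 1 : ℝ) with hs
  have hblock (j : Fin n) := exists_schwartz_sum_translates φ hφ h1 h0 (N j)
    (if j = i₀ then a else fun _ => 1) (by split_ifs; exacts [ha, by simp]) (s j)
  choose f hf1 hfs hfx using hblock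
  have hCop : Cop (fun _ : Fin n => (1 : ℝ)) (fun i => ⇑(f i)) = fun x => ∏ i, f i x := by
    funext x
    refine Cop_one_eq_prod f _ _ hfs (fun i j hij => ?_) x
    have hij' : ((i : ℕ) : ℝ) + 1 ≤ (j : ℕ) := by exact_mod_cast hij
    have := mul_le_mul_of_nonneg_right hij' (by linarith : (0 : ℝ) ≤ M + 1)
    have := hNM i
    simp only [hs]
    linarith
  refine ⟨f, fun i => HasCompactSupport.intro isCompact_Icc (hfs i), ?_⟩
  have hupper : ∏ j, eLpNorm (𝓕 ⇑(f j)) (ENNReal.ofReal (q j)) volume ≤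
      ENNReal.ofReal (2 ^ n * (M : ℝ) ^ (1 / q i₀)) := by
    have hprod : ∏ j, (2 * (N j : ℝ) ^ (1 / q j)) = 2 ^ n * (M : ℝ) ^ (1 / q i₀) := by
      rw [Finset.prod_mul_distrib, Finset.prod_const, Finset.card_univ, Fintype.card_fin,
        Finset.prod_eq_single i₀ (fun j _ hj => by simp [hN, hj]) (by simp)]
      simp [hN]
    rw [← hprod, ENNReal.ofReal_prod_of_nonneg fun j _ => by positivity]
    refine Finset.prod_le_prod' fun j _ => ?_
    refine (eLpNorm_le_of_norm_le_one (hq0 j) (by linarith [hN1 j]) (hf1 j) (hfs j)).trans ?_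
    refine ENNReal.ofReal_le_ofReal ?_
    calc (s j + N j - (s j - 1 / 4)) ^ (1 / q j)
        ≤ (2 * N j : ℝ) ^ (1 / q j) := by
          refine Real.rpow_le_rpow ?_ ?_ (one_div_pos.mpr (hq0 j)).le <;> linarith [hN1 j]
      _ = 2 ^ (1 / q j) * (N j : ℝ) ^ (1 / q j) := Real.mul_rpow two_pos.le (by positivity)
      _ ≤ 2 * (N j : ℝ) ^ (1 / q j) := by
          gcongr
          refine (Real.rpow_le_rpow_of_exponent_le one_le_two
            ((div_le_one (hq0 j)).mpr (hq1 j).le)).trans_eq (Real.rpow_one 2)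
  have hnorm_exp (t x : ℝ) : ‖exp (2 * π * I * t * x)‖ = 1 := by
    rw [show 2 * π * I * t * x = ((2 * π * t * x : ℝ) : ℂ) * I by push_cast; ring,
      norm_exp_ofReal_mul_I]
  have hlower : ENNReal.ofReal (c ^ n * √(2 ^ m) * D) ≤
      eLpNorm (fun x => ∏ i, f i x) (ENNReal.ofReal r) volume := by
    refine le_eLpNorm_of_le_norm ?_ hr (by positivity) (by positivity)
      (hE.trans (measure_mono ?_))
    · exact (continuous_finsetProd _ fun i _ => (f i).continuous).aestronglyMeasurable
    · rintro x ⟨hx, hxa⟩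
      have hfac (i : Fin n) : (if i = i₀ then √(2 ^ m) else 1) * c ≤ ‖f i x‖ := by
        rw [hfx, norm_mul, norm_mul, hnorm_exp, one_mul]
        refine mul_le_mul ?_ (hlow x hx) hc.le (norm_nonneg _)
        simp only [hN]
        split_ifs
        exacts [hxa, by simp]
      have hle := Finset.prod_le_prod (s := Finset.univ)
        (fun i _ => by split_ifs <;> positivity) fun i _ => hfac i
      rw [Finset.prod_mul_distrib, Finset.prod_const, Finset.card_univ, Fintype.card_fin,
        Finset.prod_ite_eq' Finset.univ i₀ (fun _ => √(2 ^ m)), if_pos (Finset.mem_univ _),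
        ← norm_prod, mul_comm] at hle
      exact hle
  rw [hCop]
  refine (mul_le_mul_right hupper _).trans_lt (lt_of_lt_of_le ?_ hlower)
  rw [← ENNReal.ofReal_mul hC.le]
  refine (ENNReal.ofReal_lt_ofReal_iff (by positivity)).mpr ?_
  have hsplit : √(2 ^ m) = ((2 : ℝ) ^ m) ^ θ * ((2 : ℝ) ^ m) ^ (1 / q i₀) := by
    rw [Real.sqrt_eq_rpow, ← Real.rpow_add (by positivity), hθ_def, sub_add_cancel]
  have hMcast : (M : ℝ) = 2 ^ m := by simp [hM]
  rw [hsplit, hMcast]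
  rw [div_lt_iff₀ (by positivity)] at hm
  calc C * (2 ^ n * ((2 : ℝ) ^ m) ^ (1 / q i₀))
      = C * 2 ^ n * ((2 : ℝ) ^ m) ^ (1 / q i₀) := by ring
    _ < ((2 : ℝ) ^ m) ^ θ * (c ^ n * D) * ((2 : ℝ) ^ m) ^ (1 / q i₀) := by gcongr
    _ = c ^ n * (((2 : ℝ) ^ m) ^ θ * ((2 : ℝ) ^ m) ^ (1 / q i₀)) * D := by ring
end
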